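/- arXiv:1311.6070 — 4 statements merged into one kernel-verified Lean document; each statement's English description precedes it below -/
import Mathlib

section
/- Let p and q be probability vectors on [N] such that p stochastically dominates q. Then the set M of all ergodic monotone joinings of p^ℤ and q^ℤ, viewed as a topological subspace of the space of probability measures on [N]^ℤ × [N]^ℤ equipped with the topology of weak convergence, is a nonempty Baire space. -/
open MeasureTheory

/-- The left shift on `ℤ → Fin N`. -/
def shiftMap {N : ℕ} (x : ℤ → Fin N) : ℤ → Fin N := fun i => x (i + 1)

/-- `μ` is the Bernoulli (product) measure `p^ℤ` on `(Fin N)^ℤ`. -/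
def IsBernoulli {N : ℕ} (p : Fin N → ℝ) (μ : Measure (ℤ → Fin N)) : Prop :=
  IsProbabilityMeasure μ ∧
    ∀ (s : Finset ℤ) (f : ℤ → Fin N),
      μ {x | ∀ i ∈ s, x i = f i} = ∏ i ∈ s, ENNReal.ofReal (p (f i))

/-- The set of ergodic monotone joinings of `μ` and `ν`, inside the space of probability
measures on `(Fin N)^ℤ × (Fin N)^ℤ` with the topology of weak convergence. -/
def MonotoneJoinings {N : ℕ} (μ ν : Measure (ℤ → Fin N)) :
    Set (ProbabilityMeasure ((ℤ → Fin N) × (ℤ → Fin N))) :=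
  {ζ | (ζ : Measure ((ℤ → Fin N) × (ℤ → Fin N))).map Prod.fst = μ ∧
    (ζ : Measure ((ℤ → Fin N) × (ℤ → Fin N))).map Prod.snd = ν ∧
    Ergodic (fun z => (shiftMap z.1, shiftMap z.2))
      (ζ : Measure ((ℤ → Fin N) × (ℤ → Fin N))) ∧
    (ζ : Measure ((ℤ → Fin N) × (ℤ → Fin N))) {z | z.2 0 ≤ z.1 0} = 1}

open ProbabilityTheory Filter Set Topology BoundedContinuousFunction
open scoped ENNReal NNReal symmDiff

section ErgodicGδ

variable {X : Type*} [TopologicalSpace X] [TopologicalSpace.MetrizableSpace X]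
  [MeasurableSpace X] [BorelSpace X]

/-- The probability measures invariant under a continuous map form a closed set. -/
theorem isClosed_setOf_measurePreserving {T : X → X} (hT : Continuous T) :
    IsClosed {m : ProbabilityMeasure X | MeasurePreserving T (m : Measure X) (m : Measure X)} := by
  have h : {m : ProbabilityMeasure X | MeasurePreserving T (m : Measure X) (m : Measure X)} =
      {m | m.map hT.measurable.aemeasurable = m} := by
    ext m
    refine ⟨fun h => Subtype.ext h.map_eq, fun h => ⟨hT.measurable, congrArg Subtype.val h⟩⟩
  rw [h]
  exact isClosed_eq (ProbabilityMeasure.continuous_map hT) continuous_id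

/-- An invariant probability measure fails to be ergodic exactly when it is a proper convex
combination of two distinct invariant probability measures. -/
theorem not_ergodic_iff_exists_convexCombination {T : X → X} {m : ProbabilityMeasure X}
    (hm : MeasurePreserving T (m : Measure X) (m : Measure X)) :
    ¬ Ergodic T (m : Measure X) ↔ ∃ (t : unitInterval) (m₁ m₂ : ProbabilityMeasure X),
      MeasurePreserving T (m₁ : Measure X) (m₁ : Measure X) ∧
      MeasurePreserving T (m₂ : Measure X) (m₂ : Measure X) ∧
      0 < (t : ℝ) ∧ (t : ℝ) < 1 ∧ m₁ ≠ m₂ ∧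
      ∀ f : X →ᵇ ℝ, ∫ x, f x ∂(m : Measure X) =
        t * ∫ x, f x ∂(m₁ : Measure X) + (1 - t) * ∫ x, f x ∂(m₂ : Measure X) := by
  constructor
  · intro h
    rw [Ergodic.iff_mem_extremePoints, mem_extremePoints] at h
    push Not at h
    obtain ⟨ν₁, ⟨hT₁, hp₁⟩, ν₂, ⟨hT₂, hp₂⟩, ⟨a, b, ha, hb, hab, hmab⟩, hne⟩ :=
      h ⟨hm, inferInstance⟩
    have ha1 : a ≠ ∞ := ne_top_of_le_ne_top ENNReal.one_ne_top (hab ▸ le_self_add)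
    have hb1 : b ≠ ∞ := ne_top_of_le_ne_top ENNReal.one_ne_top (hab ▸ le_add_self)
    have hsum : a.toReal + b.toReal = 1 := by
      rw [← ENNReal.toReal_add ha1 hb1, hab, ENNReal.toReal_one]
    have ha0 : 0 < a.toReal := ENNReal.toReal_pos ha.ne' ha1
    have hb0 : 0 < b.toReal := ENNReal.toReal_pos hb.ne' hb1
    refine ⟨⟨a.toReal, ha0.le, by linarith⟩, ⟨ν₁, hp₁⟩, ⟨ν₂, hp₂⟩, hT₁, hT₂, ha0,
      by simp only; linarith, ?_, fun f => ?_⟩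
    · intro heq
      have heq' : ν₁ = ν₂ := congrArg Subtype.val heq
      subst heq'
      rw [← add_smul, hab, one_smul] at hmab
      exact hne hmab hmab
    · have hf₁ : Integrable f (a • ν₁) := (f.integrable ν₁).smul_measure ha1
      have hf₂ : Integrable f (b • ν₂) := (f.integrable ν₂).smul_measure hb1
      rw [← hmab, integral_add_measure hf₁ hf₂, integral_smul_measure, integral_smul_measure]
      simp [← hsum]
  · rintro ⟨t, m₁, m₂, hT₁, hT₂, ht0, ht1, hne, hf⟩ h
    rw [Ergodic.iff_mem_extremePoints, mem_extremePoints] at h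
    have heq : ENNReal.ofReal t • (m₁ : Measure X) + ENNReal.ofReal (1 - t) • (m₂ : Measure X)
        = m := by
      have : IsFiniteMeasure (ENNReal.ofReal t • (m₁ : Measure X)) :=
        Measure.smul_finite _ ENNReal.ofReal_ne_top
      have : IsFiniteMeasure (ENNReal.ofReal (1 - t) • (m₂ : Measure X)) :=
        Measure.smul_finite _ ENNReal.ofReal_ne_top
      refine ext_of_forall_integral_eq_of_IsFiniteMeasure fun f => ?_
      rw [hf, integral_add_measure (f.integrable _) (f.integrable _), integral_smul_measure,
        integral_smul_measure, ENNReal.toReal_ofReal ht0.le,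
        ENNReal.toReal_ofReal (by linarith)]
      rfl
    obtain ⟨h₁, h₂⟩ := h.2 m₁ ⟨hT₁, inferInstance⟩ m₂ ⟨hT₂, inferInstance⟩
      ⟨_, _, ENNReal.ofReal_pos.2 ht0, ENNReal.ofReal_pos.2 (sub_pos.2 ht1), by
        rw [← ENNReal.ofReal_add ht0.le (by linarith)]; simp, heq⟩
    exact hne (Subtype.ext (h₁.trans h₂.symm))

/-- The ergodic probability measures of a continuous self-map of a compact metrizable space form
a Gδ set. -/
theorem isGδ_setOf_ergodic [CompactSpace X] {T : X → X} (hT : Continuous T) :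
    IsGδ {m : ProbabilityMeasure X | Ergodic T (m : Measure X)} := by
  let := TopologicalSpace.metrizableSpaceMetric (ProbabilityMeasure X)
  set I := {m : ProbabilityMeasure X | MeasurePreserving T (m : Measure X) (m : Measure X)}
  have hI : IsClosed I := isClosed_setOf_measurePreserving hT
  let G : ℕ → Set ((unitInterval × ProbabilityMeasure X × ProbabilityMeasure X) ×
      ProbabilityMeasure X) := fun n =>
    {z | z.1.2.1 ∈ I ∧ z.1.2.2 ∈ I ∧
      1 / ((n : ℝ) + 1) ≤ (z.1.1 : ℝ) * (1 - z.1.1) * dist z.1.2.1 z.1.2.2 ∧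
      ∀ f : X →ᵇ ℝ, ∫ x, f x ∂(z.2 : Measure X) =
        z.1.1 * ∫ x, f x ∂(z.1.2.1 : Measure X) + (1 - z.1.1) * ∫ x, f x ∂(z.1.2.2 : Measure X)}
  have hG : ∀ n, IsClosed (G n) := fun n => by
    have hle : IsClosed {z : (unitInterval × ProbabilityMeasure X × ProbabilityMeasure X) ×
        ProbabilityMeasure X |
        1 / ((n : ℝ) + 1) ≤ (z.1.1 : ℝ) * (1 - z.1.1) * dist z.1.2.1 z.1.2.2} :=
      isClosed_le (by fun_prop) (by fun_prop)
    have heq : IsClosed {z : (unitInterval × ProbabilityMeasure X × ProbabilityMeasure X) ×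
        ProbabilityMeasure X | ∀ f : X →ᵇ ℝ, ∫ x, f x ∂(z.2 : Measure X) =
        z.1.1 * ∫ x, f x ∂(z.1.2.1 : Measure X) +
          (1 - z.1.1) * ∫ x, f x ∂(z.1.2.2 : Measure X)} := by
      rw [ofPred_forall]
      refine isClosed_iInter fun f => ?_
      have hf := ProbabilityMeasure.continuous_integral_boundedContinuousFunction f
      have ht : Continuous fun z : (unitInterval × ProbabilityMeasure X × ProbabilityMeasure X) ×
        ProbabilityMeasure X => (z.1.1 : ℝ) := by fun_prop
      exact isClosed_eq (hf.comp continuous_snd) ((ht.mul (hf.comp continuous_fst.snd.fst)).add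
        ((continuous_const.sub ht).mul (hf.comp continuous_fst.snd.snd)))
    exact (hI.preimage continuous_fst.snd.fst).inter
      ((hI.preimage continuous_fst.snd.snd).inter (hle.inter heq))
  have key : {m : ProbabilityMeasure X | Ergodic T (m : Measure X)} =
      I ∩ ⋂ n, (Prod.snd '' G n)ᶜ := by
    ext m
    simp only [mem_inter_iff, mem_iInter, mem_compl_iff, mem_ofPred_eq]
    constructor
    · refine fun h => ⟨h.toMeasurePreserving, fun n => ?_⟩
      rintro ⟨⟨⟨t, m₁, m₂⟩, m'⟩, ⟨h₁, h₂, hd, hf⟩, rfl⟩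
      simp only at h₁ h₂ hd hf h
      have hd' := lt_of_lt_of_le Nat.one_div_pos_of_nat hd
      have ht0 := t.2.1
      have ht1 := t.2.2
      refine (not_ergodic_iff_exists_convexCombination h.toMeasurePreserving).2
        ⟨t, m₁, m₂, h₁, h₂, ht0.lt_of_ne ?_, ht1.lt_of_ne ?_, ?_, hf⟩ h
      · intro h0
        simp [← h0] at hd'
      · intro h0
        simp [h0] at hd'
      · rintro rfl
        simp at hd'
    · rintro ⟨hm, hn⟩
      by_contra h
      obtain ⟨t, m₁, m₂, h₁, h₂, ht0, ht1, hne, hf⟩ :=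
        (not_ergodic_iff_exists_convexCombination hm).1 h
      obtain ⟨n, hn'⟩ := exists_nat_one_div_lt
        (mul_pos (mul_pos ht0 (sub_pos.2 ht1)) (dist_pos.2 hne))
      exact hn n ⟨⟨⟨t, m₁, m₂⟩, m⟩, ⟨h₁, h₂, hn'.le, hf⟩, rfl⟩
  rw [key]
  exact hI.isGδ.inter (.iInter fun n =>
    (isClosedMap_snd_of_compactSpace _ (hG n)).isOpen_compl.isGδ)

end ErgodicGδ

section BernoulliShift

/-- Iterating the shift `n` times translates by `n`. -/
theorem shift_iterate {A : Type*} (n : ℕ) (x : ℤ → A) :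
    (fun (x : ℤ → A) (i : ℤ) => x (i + 1))^[n] x = fun i => x (i + n) := by
  induction n generalizing x with
  | zero => simp
  | succ n ih =>
    rw [Function.iterate_succ_apply, ih]
    ext i
    push_cast
    congr 1
    ring

variable {A : Type*} [MeasurableSpace A]

/-- A cylinder is independent of its sufficiently far translates under the shift. -/
theorem exists_iterate_measureReal_cylinder_inter (κ : Measure A) [IsProbabilityMeasure κ]
    {t : Set (ℤ → A)} (ht : t ∈ measurableCylinders fun _ : ℤ => A) :
    ∃ n : ℕ, (Measure.infinitePi fun _ : ℤ => κ).real
      (t ∩ (fun (x : ℤ → A) (i : ℤ) => x (i + 1))^[n] ⁻¹' t) =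
      (Measure.infinitePi fun _ : ℤ => κ).real t * (Measure.infinitePi fun _ : ℤ => κ).real
        ((fun (x : ℤ → A) (i : ℤ) => x (i + 1))^[n] ⁻¹' t) := by
  obtain ⟨I, S, hS, rfl⟩ := (mem_measurableCylinders _).1 ht
  obtain ⟨n, hn⟩ : ∃ n : ℕ, ∀ i ∈ I, ∀ j ∈ I, i ≠ j + n := by
    refine ⟨2 * I.sum Int.natAbs + 1, fun i hi j hj => ?_⟩
    have h₁ : i.natAbs ≤ I.sum Int.natAbs :=
      Finset.single_le_sum (f := Int.natAbs) (fun _ _ => Nat.zero_le _) hi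
    have h₂ : j.natAbs ≤ I.sum Int.natAbs :=
      Finset.single_le_sum (f := Int.natAbs) (fun _ _ => Nat.zero_le _) hj
    omega
  refine ⟨n, ?_⟩
  let J : Finset ℤ := I.map (addRightEmbedding (n : ℤ))
  have hJ : ∀ i : I, (i : ℤ) + n ∈ J := fun i => Finset.mem_map_of_mem _ i.2
  have hIJ : Disjoint I J := by
    rw [Finset.disjoint_left]
    intro i hi hiJ
    obtain ⟨j, hj, hji⟩ := Finset.mem_map.1 hiJ
    exact hn i hi j hj hji.symm
  let r : (J → A) → (I → A) := fun y i => y ⟨i + n, hJ i⟩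
  have hr : Measurable r := by fun_prop
  have hind : IndepFun (fun (x : ℤ → A) (i : I) => x i) (fun (x : ℤ → A) (i : J) => x i)
      (Measure.infinitePi fun _ : ℤ => κ) :=
    (iIndepFun_infinitePi (X := fun _ x => x) fun _ => measurable_id).indepFun_finset I J hIJ
      fun i => measurable_pi_apply i
  have := hind.measure_inter_preimage_eq_mul S (r ⁻¹' S) hS (hr hS)
  have hpre : (fun (x : ℤ → A) (i : ℤ) => x (i + 1))^[n] ⁻¹' cylinder I S =
      (fun (x : ℤ → A) (i : J) => x i) ⁻¹' (r ⁻¹' S) := by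
    ext x
    simp only [mem_preimage, mem_cylinder, shift_iterate]
    rfl
  rw [hpre, measureReal_def, measureReal_def, measureReal_def, ← ENNReal.toReal_mul]
  exact congrArg ENNReal.toReal this

/-- Bernoulli shifts are ergodic. -/
theorem ergodic_shift_infinitePi (κ : Measure A) [IsProbabilityMeasure κ] :
    Ergodic (fun (x : ℤ → A) (i : ℤ) => x (i + 1)) (Measure.infinitePi fun _ : ℤ => κ) := by
  set P := Measure.infinitePi fun _ : ℤ => κ with hP
  set σ : (ℤ → A) → (ℤ → A) := fun (x : ℤ → A) (i : ℤ) => x (i + 1) with hσ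
  have hmp : MeasurePreserving σ P P := ⟨by fun_prop,
    Measure.map_infinitePi_infinitePi_of_inj (P := fun _ : ℤ => κ) (add_left_injective (1 : ℤ))⟩
  refine ⟨hmp, ⟨fun s hs hinv => ?_⟩⟩
  have hsq : P.real s = P.real s * P.real s := by
    refine eq_of_abs_sub_le_all fun ε hε => ?_
    obtain ⟨t, ht, hts⟩ := exists_measure_symmDiff_lt_of_generateFrom_isSetRing (μ := P)
      isSetRing_measurableCylinders
      ⟨{univ}, countable_singleton _, by simpa using univ_mem_measurableCylinders fun _ : ℤ => A, by simp⟩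
      (generateFrom_measurableCylinders (α := fun _ : ℤ => A)).symm hs
      (ENNReal.ofReal_pos.2 (by positivity : 0 < ε / 4))
    have htm : MeasurableSet t := .of_mem_measurableCylinders ht
    have hts' : P.real (t ∆ s) ≤ ε / 4 :=
      ENNReal.toReal_le_of_le_ofReal (by positivity) hts.le
    obtain ⟨n, hn⟩ := exists_iterate_measureReal_cylinder_inter κ ht
    rw [← hP, ← hσ] at hn
    have hmn := hmp.iterate n
    have hinvn : σ^[n] ⁻¹' s = s := Function.IsFixedPt.preimage_iterate hinv n
    rw [hmn.measureReal_preimage htm.nullMeasurableSet] at hn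
    have h₁ : |P.real t - P.real s| ≤ ε / 4 :=
      (abs_measureReal_sub_le_measureReal_symmDiff htm.nullMeasurableSet
      hs.nullMeasurableSet).trans hts'
    have h₂ : |P.real (t ∩ σ^[n] ⁻¹' t) - P.real s| ≤ ε / 4 + ε / 4 := by
      refine (abs_measureReal_sub_le_measureReal_symmDiff
        (htm.inter (hmn.measurable htm)).nullMeasurableSet hs.nullMeasurableSet).trans ?_
      have hsub : (t ∩ σ^[n] ⁻¹' t) ∆ s ⊆ (t ∆ s) ∪ σ^[n] ⁻¹' (t ∆ s) := by
        rw [preimage_symmDiff, hinvn]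
        intro x
        simp only [mem_symmDiff, mem_union, mem_inter_iff]
        tauto
      refine (measureReal_mono hsub).trans ((measureReal_union_le _ _).trans ?_)
      rw [hmn.measureReal_preimage (htm.symmDiff hs).nullMeasurableSet]
      exact add_le_add hts' hts'
    rw [hn] at h₂
    have ht0 : 0 ≤ P.real t := measureReal_nonneg
    have ht1 : P.real t ≤ 1 := measureReal_le_one
    have hs0 : 0 ≤ P.real s := measureReal_nonneg
    have hs1 : P.real s ≤ 1 := measureReal_le_one
    rw [abs_le] at h₁ h₂ ⊢
    constructor <;> nlinarith
  have h01 : P.real s = 0 ∨ P.real s = 1 := by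
    have : P.real s * (P.real s - 1) = 0 := by linarith
    rcases mul_eq_zero.1 this with h | h
    · exact .inl h
    · exact .inr (by linarith)
  rw [eventuallyConst_set']
  refine h01.imp (fun h => ?_) fun h => ?_
  · rwa [ae_eq_empty, ← measureReal_eq_zero_iff]
  · rw [ae_eq_univ, ← measureReal_eq_zero_iff, probReal_compl_eq_one_sub hs, h, sub_self]

end BernoulliShift

section Coupling

/-- The probability measure on `Fin N` with weights `p`. -/
noncomputable def weightMeasure {N : ℕ} (p : Fin N → ℝ) : Measure (Fin N) :=
  ∑ i, ENNReal.ofReal (p i) • Measure.dirac i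

theorem weightMeasure_apply {N : ℕ} {p : Fin N → ℝ} (hp : ∀ i, 0 ≤ p i) (s : Finset (Fin N)) :
    weightMeasure p (s : Set (Fin N)) = ENNReal.ofReal (∑ i ∈ s, p i) := by
  classical
  rw [ENNReal.ofReal_sum_of_nonneg fun i _ => hp i]
  simp [weightMeasure, Set.indicator_apply, Finset.sum_ite_mem]

theorem isProbabilityMeasure_weightMeasure {N : ℕ} {p : Fin N → ℝ} (hp : ∀ i, 0 ≤ p i)
    (hp1 : ∑ i, p i = 1) : IsProbabilityMeasure (weightMeasure p) :=
  ⟨by rw [← Finset.coe_univ, weightMeasure_apply hp, hp1, ENNReal.ofReal_one]⟩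

/-- The quantile function of a probability vector. -/
theorem exists_quantile {n : ℕ} {p : Fin (n + 1) → ℝ} (hp : ∀ i, 0 ≤ p i) :
    ∃ a : ℝ → Fin (n + 1), ∀ u k, a u ≤ k ↔ u < ∑ i ∈ Finset.Iic k, p i ∨ k = ⊤ := by
  classical
  let F : ℝ → Finset (Fin (n + 1)) := fun u =>
    Finset.univ.filter fun k => u < ∑ i ∈ Finset.Iic k, p i ∨ k = ⊤
  have hF : ∀ u, (F u).Nonempty := fun u => ⟨⊤, by simp [F]⟩
  refine ⟨fun u => (F u).min' (hF u), fun u k => ⟨fun h => ?_, fun h => ?_⟩⟩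
  · rcases (Finset.mem_filter.1 ((F u).min'_mem (hF u))).2 with h' | h'
    · exact .inl (h'.trans_le (Finset.sum_le_sum_of_subset_of_nonneg
        (Finset.Iic_subset_Iic.2 h) fun i _ _ => hp i))
    · exact .inr (top_le_iff.1 (h' ▸ h))
  · exact (F u).min'_le k (by simpa [F] using h)

/-- The quantile function pushes Lebesgue measure on the unit interval to the given law. -/
theorem map_quantile {n : ℕ} {p : Fin (n + 1) → ℝ} (hp : ∀ i, 0 ≤ p i) (hp1 : ∑ i, p i = 1)
    {a : ℝ → Fin (n + 1)}
    (ha : ∀ u k, a u ≤ k ↔ u < ∑ i ∈ Finset.Iic k, p i ∨ k = ⊤) :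
    Measurable a ∧ (volume.restrict (Ico (0 : ℝ) 1)).map a = weightMeasure p := by
  have hpre : ∀ k, a ⁻¹' Iic k = {u | u < ∑ i ∈ Finset.Iic k, p i ∨ k = ⊤} := fun k => by
    ext u
    exact ha u k
  have hm : Measurable a := measurable_of_Iic fun k => by
    rw [hpre]
    exact measurableSet_Iio.union (.const _)
  refine ⟨hm, Measure.ext_of_Iic _ _ fun k => ?_⟩
  have hle : ∑ i ∈ Finset.Iic k, p i ≤ 1 :=
    hp1 ▸ Finset.sum_le_sum_of_subset_of_nonneg (Finset.subset_univ _) fun i _ _ => hp i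
  rw [Measure.map_apply hm measurableSet_Iic, Measure.restrict_apply (hm measurableSet_Iic), hpre,
    ← Finset.coe_Iic, weightMeasure_apply hp]
  have : {u | u < ∑ i ∈ Finset.Iic k, p i ∨ k = ⊤} ∩ Ico (0 : ℝ) 1 =
      Ico 0 (∑ i ∈ Finset.Iic k, p i) := by
    ext u
    simp only [mem_inter_iff, mem_ofPred_eq, mem_Ico]
    constructor
    · rintro ⟨h | rfl, h0, h1⟩
      · exact ⟨h0, h⟩
      · exact ⟨h0, by rwa [Finset.Iic_top, hp1]⟩
    · exact fun h => ⟨.inl h.2, h.1, h.2.trans_le hle⟩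
  rw [this, Real.volume_Ico, sub_zero]

/-- Strassen's theorem on `Fin N`: stochastic domination yields a monotone coupling. -/
theorem exists_monotone_coupling {N : ℕ} {p q : Fin N → ℝ}
    (hp0 : ∀ i, 0 ≤ p i) (hp1 : ∑ i, p i = 1) (hq0 : ∀ i, 0 ≤ q i) (hq1 : ∑ i, q i = 1)
    (hdom : ∀ k : Fin N, ∑ i ∈ Finset.Iic k, p i ≤ ∑ i ∈ Finset.Iic k, q i) :
    ∃ κ : Measure (Fin N × Fin N), κ.map Prod.fst = weightMeasure p ∧
      κ.map Prod.snd = weightMeasure q ∧ κ {z | z.2 ≤ z.1} = 1 := by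
  obtain _ | n := N
  · simp at hp1
  obtain ⟨a, ha⟩ := exists_quantile hp0
  obtain ⟨b, hb⟩ := exists_quantile hq0
  obtain ⟨ham, hap⟩ := map_quantile hp0 hp1 ha
  obtain ⟨hbm, hbq⟩ := map_quantile hq0 hq1 hb
  refine ⟨(volume.restrict (Ico (0 : ℝ) 1)).map fun u => (a u, b u), ?_, ?_, ?_⟩
  · rw [Measure.map_map measurable_fst (ham.prodMk hbm), ← hap]
    rfl
  · rw [Measure.map_map measurable_snd (ham.prodMk hbm), ← hbq]
    rfl
  · have hle : ∀ u, b u ≤ a u := fun u =>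
      (hb u _).2 (((ha u _).1 le_rfl).imp_left fun h => h.trans_le (hdom _))
    rw [Measure.map_apply (ham.prodMk hbm) (Set.toFinite _).measurableSet]
    simp [hle]

end Coupling

theorem IsBernoulli.eq_infinitePi {N : ℕ} {p : Fin N → ℝ} (hp0 : ∀ i, 0 ≤ p i)
    (hp1 : ∑ i, p i = 1) {μ : Measure (ℤ → Fin N)} (hμ : IsBernoulli p μ) :
    μ = Measure.infinitePi fun _ : ℤ => weightMeasure p := by
  have := isProbabilityMeasure_weightMeasure hp0 hp1
  have := hμ.1
  have hN : Nonempty (Fin N) := by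
    by_contra h
    simp only [not_nonempty_iff] at h
    simp at hp1
  refine ((Measure.isProjectiveLimit_infinitePi fun _ : ℤ => weightMeasure p).unique fun I => ?_).symm
  refine Measure.ext_of_singleton fun y => ?_
  classical
  rw [Measure.map_apply (Finset.measurable_restrict I) (measurableSet_singleton _),
    Measure.pi_singleton]
  let f : ℤ → Fin N := fun i => if h : i ∈ I then y ⟨i, h⟩ else Classical.arbitrary _
  have hpre : I.restrict ⁻¹' ({y} : Set (I → Fin N)) = {x : ℤ → Fin N | ∀ i ∈ I, x i = f i} := by
    ext x
    simp only [mem_preimage, mem_singleton_iff, mem_ofPred_eq, funext_iff, Subtype.forall]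
    refine forall₂_congr fun i hi => ?_
    simp [f, hi]
  rw [hpre, hμ.2, ← Finset.prod_coe_sort]
  refine Finset.prod_congr rfl fun i _ => ?_
  rw [← Finset.coe_singleton, weightMeasure_apply hp0]
  simp [f]

/-- The shift is continuous. -/
theorem continuous_shiftMap {N : ℕ} : Continuous (shiftMap (N := N)) :=
  continuous_pi fun i => continuous_apply (i + 1)

theorem monotoneJoinings_nonempty {N : ℕ} {p q : Fin N → ℝ}
    (hp0 : ∀ i, 0 ≤ p i) (hp1 : ∑ i, p i = 1) (hq0 : ∀ i, 0 ≤ q i) (hq1 : ∑ i, q i = 1)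
    (hdom : ∀ k : Fin N, ∑ i ∈ Finset.Iic k, p i ≤ ∑ i ∈ Finset.Iic k, q i)
    {μ ν : Measure (ℤ → Fin N)} (hμ : IsBernoulli p μ) (hν : IsBernoulli q ν) :
    (MonotoneJoinings μ ν).Nonempty := by
  obtain ⟨κ, hκp, hκq, hκ⟩ := exists_monotone_coupling hp0 hp1 hq0 hq1 hdom
  have hprob : IsProbabilityMeasure κ := by
    have := isProbabilityMeasure_weightMeasure hp0 hp1
    rw [← hκp] at this
    exact Measure.isProbabilityMeasure_of_map Prod.fst
  set P := Measure.infinitePi fun _ : ℤ => κ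
  let Φ : (ℤ → Fin N × Fin N) → (ℤ → Fin N) × (ℤ → Fin N) :=
    fun w => (fun i => (w i).1, fun i => (w i).2)
  have hΦ : Measurable Φ := by fun_prop
  have hmeas : Measurable fun z : (ℤ → Fin N) × (ℤ → Fin N) => (shiftMap z.1, shiftMap z.2) :=
    (continuous_shiftMap.measurable.comp measurable_fst).prodMk
      (continuous_shiftMap.measurable.comp measurable_snd)
  have hset : MeasurableSet {z : (ℤ → Fin N) × (ℤ → Fin N) | z.2 0 ≤ z.1 0} :=
    measurableSet_le (by fun_prop) (by fun_prop)
  refine ⟨⟨P.map Φ, Measure.isProbabilityMeasure_map hΦ.aemeasurable⟩, ?_, ?_, ?_, ?_⟩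
  · rw [hμ.eq_infinitePi hp0 hp1, ← hκp, ← Measure.infinitePi_map_pi _ fun _ => measurable_fst]
    exact Measure.map_map measurable_fst hΦ
  · rw [hν.eq_infinitePi hq0 hq1, ← hκq, ← Measure.infinitePi_map_pi _ fun _ => measurable_snd]
    exact Measure.map_map measurable_snd hΦ
  · exact (hΦ.measurePreserving P).ergodic_of_ergodic_semiconj (ergodic_shift_infinitePi κ)
      hmeas fun _ => rfl
  · change P.map Φ _ = 1
    rw [Measure.map_apply hΦ hset, ← hκ, ← Measure.infinitePi_map_eval (fun _ : ℤ => κ) 0,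
      Measure.map_apply (by fun_prop) (Set.toFinite _).measurableSet]
    rfl

theorem isGδ_monotoneJoinings {N : ℕ} (μ ν : Measure (ℤ → Fin N)) [IsProbabilityMeasure μ]
    [IsProbabilityMeasure ν] : IsGδ (MonotoneJoinings μ ν) := by
  have hfst : IsClosed {ζ : ProbabilityMeasure ((ℤ → Fin N) × (ℤ → Fin N)) |
      ζ.map (measurable_fst.aemeasurable) = ⟨μ, inferInstance⟩} :=
    isClosed_eq (ProbabilityMeasure.continuous_map continuous_fst) continuous_const
  have hsnd : IsClosed {ζ : ProbabilityMeasure ((ℤ → Fin N) × (ℤ → Fin N)) |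
      ζ.map (measurable_snd.aemeasurable) = ⟨ν, inferInstance⟩} :=
    isClosed_eq (ProbabilityMeasure.continuous_map continuous_snd) continuous_const
  have hclopen : IsClopen {z : (ℤ → Fin N) × (ℤ → Fin N) | z.2 0 ≤ z.1 0} :=
    (isClopen_discrete {y : Fin N × Fin N | y.2 ≤ y.1}).preimage
      (f := fun z : (ℤ → Fin N) × (ℤ → Fin N) => (z.1 0, z.2 0)) (by fun_prop)
  have hmono : IsClosed {ζ : ProbabilityMeasure ((ℤ → Fin N) × (ℤ → Fin N)) |
      (ζ : Measure ((ℤ → Fin N) × (ℤ → Fin N))) {z | z.2 0 ≤ z.1 0} = 1} := by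
    refine isClosed_eq (continuous_iff_continuousAt.2 fun ζ => ?_) continuous_const
    exact ProbabilityMeasure.tendsto_measure_of_null_frontier_of_tendsto' tendsto_id
      (by simp [hclopen.frontier_eq])
  have herg := isGδ_setOf_ergodic
    (T := fun z : (ℤ → Fin N) × (ℤ → Fin N) => (shiftMap z.1, shiftMap z.2))
    ((continuous_shiftMap.comp continuous_fst).prodMk (continuous_shiftMap.comp continuous_snd))
  convert hfst.isGδ.inter (hsnd.isGδ.inter (herg.inter hmono.isGδ)) using 1
  ext ζ
  exact and_congr (Subtype.ext_iff (a1 := ζ.map measurable_fst.aemeasurable)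
    (a2 := ⟨μ, inferInstance⟩)).symm
    (and_congr (Subtype.ext_iff (a1 := ζ.map measurable_snd.aemeasurable)
      (a2 := ⟨ν, inferInstance⟩)).symm Iff.rfl)

/-- If `p` stochastically dominates `q`, then the space of ergodic monotone joinings of `p^ℤ`
and `q^ℤ` is a nonempty Baire space (in the topology of weak convergence). -/
theorem monotone_joinings_baire {N : ℕ} (p q : Fin N → ℝ)
    (hp0 : ∀ i, 0 ≤ p i) (hp1 : ∑ i, p i = 1)
    (hq0 : ∀ i, 0 ≤ q i) (hq1 : ∑ i, q i = 1)
    (hdom : ∀ k : Fin N, ∑ i ∈ Finset.Iic k, p i ≤ ∑ i ∈ Finset.Iic k, q i)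
    (μ ν : Measure (ℤ → Fin N)) (hμ : IsBernoulli p μ) (hν : IsBernoulli q ν) :
    (MonotoneJoinings μ ν).Nonempty ∧ BaireSpace ↥(MonotoneJoinings μ ν) := by
  have := hμ.1
  have := hν.1
  exact ⟨monotoneJoinings_nonempty hp0 hp1 hq0 hq1 hdom hμ hν,
    (isGδ_monotoneJoinings μ ν).baireSpace_of_t2Space_locallyCompactSpace⟩
end

section
/- Let p and q be probability vectors on [N] and let ζ be a joining of p^ℤ and q^ℤ that is an ε-almost factor for every ε > 0. Then there exists a factor map φ from ([N]^ℤ, p^ℤ, S) to ([N]^ℤ, q^ℤ, S) such that ζ(F × G) = p^ℤ(F ∩ φ^{-1}(G)) for all Borel sets F, G ⊆ [N]^ℤ. -/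
open MeasureTheory

/-- `ζ` is an `ε`-almost factor: for every set `P` in the σ-algebra generated by the
zero-coordinate partition of the second factor (i.e. every set `{y | y 0 ∈ A}`), there is a
Borel set `P'` with `ζ((P' × X) Δ (X × P)) < ε`. -/
def IsAlmostFactor {N : ℕ} (ζ : Measure ((ℤ → Fin N) × (ℤ → Fin N))) (ε : ℝ) : Prop :=
  ∀ A : Set (Fin N), ∃ P' : Set (ℤ → Fin N), MeasurableSet P' ∧
    ζ (symmDiff (P' ×ˢ (Set.univ : Set (ℤ → Fin N)))
        ((Set.univ : Set (ℤ → Fin N)) ×ˢ {y | y 0 ∈ A})) < ENNReal.ofReal ε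

open Filter

/-- A set in `β` that can be approximated arbitrarily well, modulo `ζ`, by measurable sets in `α`
agrees `ζ`-almost everywhere with a measurable set in `α`. -/
theorem exists_measurableSet_ae_iff_of_approx {α β : Type*} [MeasurableSpace α]
    [MeasurableSpace β] {ζ : Measure (α × β)} {P : Set β}
    (h : ∀ ε : ℝ, 0 < ε → ∃ P' : Set α, MeasurableSet P' ∧
      ζ (symmDiff (P' ×ˢ (Set.univ : Set β)) ((Set.univ : Set α) ×ˢ P)) < ENNReal.ofReal ε) :
    ∃ Q : Set α, MeasurableSet Q ∧ ∀ᵐ z ∂ζ, z.1 ∈ Q ↔ z.2 ∈ P := by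
  choose P' hP' hlt using fun n : ℕ => h ((1 / 2 : ℝ) ^ n) (by positivity)
  refine ⟨limsup P' atTop, .measurableSet_limsup hP', ?_⟩
  have hsum : ∑' n, ζ (symmDiff (P' n ×ˢ (Set.univ : Set β)) ((Set.univ : Set α) ×ˢ P)) ≠ ⊤ := by
    refine ne_top_of_le_ne_top ?_ (ENNReal.tsum_le_tsum fun n => (hlt n).le)
    rw [← ENNReal.ofReal_tsum_of_nonneg (fun n => by positivity) summable_geometric_two]
    exact ENNReal.ofReal_ne_top
  filter_upwards [ae_eventually_notMem hsum] with z hz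
  have hiff : ∀ᶠ n in atTop, (z.1 ∈ P' n ↔ z.2 ∈ P) := by
    filter_upwards [hz] with n hn
    simp only [Set.mem_symmDiff, Set.mem_prod, Set.mem_univ, and_true, true_and] at hn
    tauto
  rw [mem_limsup_iff_frequently_mem, frequently_congr hiff, frequently_const]

/-- Translation by `n` on two-sided sequences. -/
def seqTranslate {α : Type*} (n : ℤ) (x : ℤ → α) : ℤ → α := fun i => x (i + n)

theorem measurable_seqTranslate {α : Type*} [MeasurableSpace α] (n : ℤ) :
    Measurable (seqTranslate n : (ℤ → α) → ℤ → α) :=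
  measurable_pi_lambda _ fun i => measurable_pi_apply (i + n)

theorem seqTranslate_seqTranslate {α : Type*} (m n : ℤ) (x : ℤ → α) :
    seqTranslate m (seqTranslate n x) = seqTranslate (m + n) x := by
  funext i
  simp only [seqTranslate, add_assoc]

theorem seqTranslate_zero {α : Type*} (x : ℤ → α) : seqTranslate 0 x = x := by
  funext i
  simp only [seqTranslate, add_zero]

theorem shiftMap_eq_seqTranslate {N : ℕ} (x : ℤ → Fin N) : shiftMap x = seqTranslate 1 x := rfl

/-- A measure invariant under the diagonal shift is invariant under all diagonal translations. -/
theorem measurePreserving_seqTranslate {N : ℕ} {ζ : Measure ((ℤ → Fin N) × (ℤ → Fin N))}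
    (h : MeasurePreserving (fun z => (shiftMap z.1, shiftMap z.2)) ζ ζ) (n : ℤ) :
    MeasurePreserving (Prod.map (seqTranslate n) (seqTranslate n)) ζ ζ := by
  have hmeas (k : ℤ) : Measurable
      (Prod.map (seqTranslate k) (seqTranslate k) : (ℤ → Fin N) × (ℤ → Fin N) → _) :=
    (measurable_seqTranslate k).prodMap (measurable_seqTranslate k)
  have hcomp (k l : ℤ) : (Prod.map (seqTranslate k) (seqTranslate k) ∘
      Prod.map (seqTranslate l) (seqTranslate l) : (ℤ → Fin N) × (ℤ → Fin N) → _) =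
      Prod.map (seqTranslate (k + l)) (seqTranslate (k + l)) := by
    funext z
    simp only [Function.comp_apply, Prod.map, seqTranslate_seqTranslate]
  have hzero : (Prod.map (seqTranslate 0) (seqTranslate 0) :
      (ℤ → Fin N) × (ℤ → Fin N) → _) = id := by
    funext z
    simp only [Prod.map, seqTranslate_zero, id]
  have hone : MeasurePreserving (Prod.map (seqTranslate 1) (seqTranslate 1)) ζ ζ := h
  have hneg : MeasurePreserving (Prod.map (seqTranslate (-1)) (seqTranslate (-1))) ζ ζ := by
    refine ⟨hmeas _, ?_⟩
    conv_lhs => rw [← hone.map_eq]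
    rw [Measure.map_map (hmeas _) (hmeas _), hcomp, neg_add_cancel, hzero, Measure.map_id]
  induction n using Int.induction_on with
  | zero => exact hzero ▸ MeasurePreserving.id ζ
  | succ k ih => exact hcomp _ _ ▸ ih.comp hone
  | pred k ih => exact sub_eq_add_neg (-(k : ℤ)) 1 ▸ hcomp _ _ ▸ ih.comp hneg

/-- If each event `{f = i}` agrees almost everywhere with a measurable event in the first
coordinate, then `f` is almost everywhere a measurable function of the first coordinate. -/
theorem exists_measurable_ae_eq_of_ae_iff {α β ι : Type*} [MeasurableSpace α] [MeasurableSpace β]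
    [Finite ι] [Nonempty ι] [MeasurableSpace ι] {ζ : Measure (α × β)} {f : β → ι} {Q : ι → Set α}
    (hQ : ∀ i, MeasurableSet (Q i)) (h : ∀ i, ∀ᵐ z ∂ζ, z.1 ∈ Q i ↔ f z.2 = i) :
    ∃ ψ : α → ι, Measurable ψ ∧ ∀ᵐ z ∂ζ, ψ z.1 = f z.2 := by
  refine ⟨fun x => Classical.epsilon fun i => x ∈ Q i, ?_, ?_⟩
  · have hb : Measurable fun x i => x ∈ Q i :=
      measurable_pi_lambda _ fun i => measurable_mem.mpr (hQ i)
    exact (measurable_of_countable fun b : ι → Prop => Classical.epsilon b).comp hb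
  · filter_upwards [ae_all_iff.mpr h] with z hz
    exact ((hz _).mp (Classical.epsilon_spec (p := fun i => z.1 ∈ Q i)
      ⟨f z.2, (hz _).mpr rfl⟩)).symm

/-- A joining that is an `ε`-almost factor for every `ε > 0` is a factor: it is supported on
the graph of a factor map `φ`. -/
theorem almost_factor_forall_is_factor {N : ℕ} (p q : Fin N → ℝ)
    (hp0 : ∀ i, 0 ≤ p i) (hp1 : ∑ i, p i = 1)
    (hq0 : ∀ i, 0 ≤ q i) (hq1 : ∑ i, q i = 1)
    (μ ν : Measure (ℤ → Fin N)) (hμ : IsBernoulli p μ) (hν : IsBernoulli q ν)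
    (ζ : Measure ((ℤ → Fin N) × (ℤ → Fin N))) (hζ : IsProbabilityMeasure ζ)
    (hζ1 : ζ.map Prod.fst = μ) (hζ2 : ζ.map Prod.snd = ν)
    (hζinv : MeasurePreserving (fun z => (shiftMap z.1, shiftMap z.2)) ζ ζ)
    (hε : ∀ ε : ℝ, 0 < ε → IsAlmostFactor ζ ε) :
    ∃ φ : (ℤ → Fin N) → (ℤ → Fin N),
      Measurable φ ∧ μ.map φ = ν ∧
      (∀ᵐ x ∂μ, φ (shiftMap x) = shiftMap (φ x)) ∧
      ∀ F G : Set (ℤ → Fin N), MeasurableSet F → MeasurableSet G →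
        ζ (F ×ˢ G) = μ (F ∩ φ ⁻¹' G) := by
  have : Nonempty (Fin N) := by
    by_contra hN
    rw [not_nonempty_iff] at hN
    simp at hp1
  choose Q hQ hQiff using fun i : Fin N =>
    exists_measurableSet_ae_iff_of_approx fun ε hpos => hε ε hpos {i}
  obtain ⟨ψ, hψ, hψ_eq⟩ := exists_measurable_ae_eq_of_ae_iff
    (f := fun y : ℤ → Fin N => y 0) hQ hQiff
  let φ : (ℤ → Fin N) → ℤ → Fin N := fun x n => ψ (seqTranslate n x)
  have hφ : Measurable φ := measurable_pi_lambda _ fun n => hψ.comp (measurable_seqTranslate n)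
  have hφ_eq : ∀ᵐ z ∂ζ, φ z.1 = z.2 := by
    have hall (n : ℤ) : ∀ᵐ z ∂ζ, ψ (seqTranslate n z.1) = z.2 n := by
      filter_upwards [(measurePreserving_seqTranslate hζinv n).quasiMeasurePreserving.ae hψ_eq]
        with z hz
      simpa [seqTranslate] using hz
    filter_upwards [ae_all_iff.mpr hall] with z hz
    exact funext hz
  have hgraph (F G : Set (ℤ → Fin N)) (hF : MeasurableSet F) (hG : MeasurableSet G) :
      ζ (F ×ˢ G) = μ (F ∩ φ ⁻¹' G) := by
    rw [← hζ1, Measure.map_apply measurable_fst (hF.inter (hφ hG))]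
    refine measure_congr (eventuallyEq_set.mpr ?_)
    filter_upwards [hφ_eq] with z hz
    simp [hz]
  refine ⟨φ, hφ, ?_, ae_of_all _ fun x => ?_, hgraph⟩
  · rw [← hζ1, ← hζ2, Measure.map_map hφ measurable_fst]
    exact Measure.map_congr hφ_eq
  · funext n
    change ψ (seqTranslate n (shiftMap x)) = ψ (seqTranslate (n + 1) x)
    rw [shiftMap_eq_seqTranslate, seqTranslate_seqTranslate]
end

section
/- Let p and q be probability vectors on [N] with p stochastically dominating q, and let M be the set of all ergodic monotone joinings of p^ℤ and q^ℤ, equipped with the subspace topology inherited from the topology of weak convergence of probability measures on [N]^ℤ × [N]^ℤ. Then for every ε > 0, the set of elements of M that are ε-almost factors is a relatively open subset of M. -/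
open MeasureTheory

/-- A measurable set in a Stone space is approximated in measure by a clopen set. -/
theorem exists_isClopen_measure_symmDiff_lt {X : Type*} [TopologicalSpace X] [CompactSpace X]
    [T2Space X] [TotallyDisconnectedSpace X] [MeasurableSpace X] [BorelSpace X]
    (μ : Measure X) [IsFiniteMeasure μ] [μ.WeaklyRegular] {P : Set X} (hP : MeasurableSet P)
    {δ : ENNReal} (hδ : δ ≠ 0) :
    ∃ C : Set X, IsClopen C ∧ μ (symmDiff C P) < δ := by
  have hδ2 : δ / 2 ≠ 0 := by simpa using hδ
  obtain ⟨U, hPU, hU, -, hμU⟩ := hP.exists_isOpen_sdiff_lt (measure_ne_top μ P) hδ2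
  obtain ⟨F, hFP, hF, hμF⟩ := hP.exists_isClosed_sdiff_lt (measure_ne_top μ P) hδ2
  obtain ⟨C, hC, hFC, hCU⟩ := exists_clopen_of_closed_subset_open hF hU (hFP.trans hPU)
  refine ⟨C, hC, ?_⟩
  calc μ (symmDiff C P) ≤ μ (C \ P) + μ (P \ C) := measure_union_le _ _
    _ ≤ μ (U \ P) + μ (P \ F) := by gcongr
    _ < δ / 2 + δ / 2 := ENNReal.add_lt_add hμU hμF
    _ = δ := ENNReal.add_halves δ

/-- In the topology of weak convergence, the measure of a clopen set is continuous. -/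
theorem continuous_measure_of_isClopen {Ω : Type*} [TopologicalSpace Ω] [MeasurableSpace Ω]
    [OpensMeasurableSpace Ω] [HasOuterApproxClosed Ω] {E : Set Ω} (hE : IsClopen E) :
    Continuous fun ζ : ProbabilityMeasure Ω => (ζ : Measure Ω) E := by
  have h : Continuous fun ζ : ProbabilityMeasure Ω => ζ E :=
    continuous_iff_continuousAt.2 fun ζ =>
      ProbabilityMeasure.tendsto_measure_of_isClopen_of_tendsto Filter.tendsto_id hE
  simpa only [Function.comp_def, ProbabilityMeasure.ennreal_coeFn_eq_coeFn_toMeasure] using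
    ENNReal.continuous_coe.comp h

/-- An event of the second factor that is close to an event of the first factor is close to a
clopen event of the first factor. -/
theorem exists_isClopen_measure_symmDiff_prod_lt {X Y : Type*} [TopologicalSpace X]
    [CompactSpace X] [T2Space X] [TotallyDisconnectedSpace X] [MeasurableSpace X] [BorelSpace X]
    [MeasurableSpace Y] (ζ : Measure (X × Y)) [IsFiniteMeasure ζ]
    [(ζ.map Prod.fst).WeaklyRegular] {P : Set X} (hP : MeasurableSet P) {B : Set (X × Y)}
    {c : ENNReal} (h : ζ (symmDiff (P ×ˢ Set.univ) B) < c) :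
    ∃ C : Set X, IsClopen C ∧ ζ (symmDiff (C ×ˢ Set.univ) B) < c := by
  obtain ⟨C, hC, hCP⟩ := exists_isClopen_measure_symmDiff_lt (ζ.map Prod.fst) hP
    (tsub_pos_of_lt h).ne'
  refine ⟨C, hC, ?_⟩
  rw [Measure.map_apply measurable_fst (hC.isOpen.measurableSet.symmDiff hP), Set.preimage_symmDiff,
    ← Set.prod_univ, ← Set.prod_univ] at hCP
  calc ζ (symmDiff (C ×ˢ Set.univ) B)
      ≤ ζ (symmDiff (C ×ˢ Set.univ) (P ×ˢ Set.univ)) + ζ (symmDiff (P ×ˢ Set.univ) B) :=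
        measure_symmDiff_le _ _ _
    _ < (c - ζ (symmDiff (P ×ˢ Set.univ) B)) + ζ (symmDiff (P ×ˢ Set.univ) B) :=
        ENNReal.add_lt_add_right (measure_ne_top _ _) hCP
    _ = c := tsub_add_cancel_of_le h.le

/-- The `ε`-almost factors form an open set of probability measures. -/
theorem isOpen_setOf_isAlmostFactor (N : ℕ) (ε : ℝ) :
    IsOpen {ζ : ProbabilityMeasure ((ℤ → Fin N) × (ℤ → Fin N)) |
      IsAlmostFactor (ζ : Measure ((ℤ → Fin N) × (ℤ → Fin N))) ε} := by
  simp only [IsAlmostFactor, Set.ofPred_forall]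
  refine isOpen_iInter_of_finite fun A => isOpen_iff_mem_nhds.2 fun ζ ⟨P, hP, hlt⟩ => ?_
  obtain ⟨C, hC, hClt⟩ := exists_isClopen_measure_symmDiff_prod_lt
    (ζ : Measure ((ℤ → Fin N) × (ℤ → Fin N))) hP hlt
  have hA : IsClopen ((Set.univ : Set (ℤ → Fin N)) ×ˢ {y : ℤ → Fin N | y 0 ∈ A}) :=
    isClopen_univ.prod ((isClopen_discrete A).preimage (continuous_apply 0))
  have hD : IsClopen (symmDiff (C ×ˢ (Set.univ : Set (ℤ → Fin N)))
      ((Set.univ : Set (ℤ → Fin N)) ×ˢ {y : ℤ → Fin N | y 0 ∈ A})) :=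
    ((hC.prod isClopen_univ).diff hA).union (hA.diff (hC.prod isClopen_univ))
  filter_upwards [(continuous_measure_of_isClopen hD).continuousAt.eventually_lt_const hClt]
    with ξ hξ
  exact ⟨C, hC.isOpen.measurableSet, hξ⟩

/-- The `ε`-almost factors form a relatively open subset of the space of ergodic monotone
joinings. -/
theorem almost_factors_open {N : ℕ} (p q : Fin N → ℝ)
    (hp0 : ∀ i, 0 ≤ p i) (hp1 : ∑ i, p i = 1)
    (hq0 : ∀ i, 0 ≤ q i) (hq1 : ∑ i, q i = 1)
    (hdom : ∀ k : Fin N, ∑ i ∈ Finset.Iic k, p i ≤ ∑ i ∈ Finset.Iic k, q i)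
    (μ ν : Measure (ℤ → Fin N)) (hμ : IsBernoulli p μ) (hν : IsBernoulli q ν)
    (ε : ℝ) (hε : 0 < ε) :
    IsOpen {ζ : ↥(MonotoneJoinings μ ν) |
      IsAlmostFactor ((ζ : ProbabilityMeasure ((ℤ → Fin N) × (ℤ → Fin N))) :
        Measure ((ℤ → Fin N) × (ℤ → Fin N))) ε} := by
  exact (isOpen_setOf_isAlmostFactor N ε).preimage continuous_subtype_val
end

section
/- Let p and q be probability vectors on [N] with H(p) > H(q) and p stochastically dominating q, and let M be the set of all ergodic monotone joinings of p^ℤ and q^ℤ, equipped with the subspace topology inherited from the topology of weak convergence of probability measures on [N]^ℤ × [N]^ℤ. Then for every ε > 0, the set of elements of M that are ε-almost factors is dense in M. -/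
open MeasureTheory

/-- Shannon entropy of a probability vector. -/
noncomputable def shannonH {N : ℕ} (p : Fin N → ℝ) : ℝ :=
  -∑ i, p i * Real.log (p i)

namespace MonotoneSinai

open MeasureTheory ProbabilityTheory Filter Topology

/-- A nonnegative vector may be replaced by one of small support with the same image under a linear
map. -/
theorem exists_small_support {S V : Type*} [Fintype S] [AddCommGroup V] [Module ℝ V]
    [FiniteDimensional ℝ V] (T : (S → ℝ) →ₗ[ℝ] V) (w : S → ℝ) (hw : 0 ≤ w) :
    ∃ w' : S → ℝ, 0 ≤ w' ∧ (∀ s, w s = 0 → w' s = 0) ∧ T w' = T w ∧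
      (Finset.univ.filter fun s => w' s ≠ 0).card ≤ Module.finrank ℝ V := by
  classical
  induction h : (Finset.univ.filter fun s => w s ≠ 0).card using Nat.strong_induction_on
    generalizing w with
  | _ k ih =>
  by_cases hk : k ≤ Module.finrank ℝ V
  · exact ⟨w, hw, fun _ h => h, rfl, h.le.trans hk⟩
  push Not at hk
  set E := Function.ExtendByZero.linearMap ℝ (Subtype.val : {s // w s ≠ 0} → S)
  have hker : LinearMap.ker (T ∘ₗ E) ≠ ⊥ := by
    apply LinearMap.ker_ne_bot_of_finrank_lt
    rwa [Module.finrank_fintype_fun_eq_card, Fintype.card_subtype, h]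
  obtain ⟨g₀, hg₀, hg₀'⟩ := Submodule.exists_mem_ne_zero_of_ne_bot hker
  obtain ⟨s₀, hs₀⟩ := Function.ne_iff.1 hg₀'
  obtain ⟨g, hTg, hgw, s₁, hs₁⟩ : ∃ g : S → ℝ, T g = 0 ∧ (∀ s, w s = 0 → g s = 0) ∧
      ∃ s, 0 < g s := by
    have hE0 : ∀ s, w s = 0 → E g₀ s = 0 := by
      intro s hs
      exact Function.extend_apply' _ _ _ (by rintro ⟨a, rfl⟩; exact a.2 hs)
    have hE1 : E g₀ s₀ = g₀ s₀ := Subtype.val_injective.extend_apply _ _ _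
    have hT : T (E g₀) = 0 := hg₀
    rcases lt_or_gt_of_ne hs₀ with hlt | hgt
    · refine ⟨-E g₀, by simp [hT], fun s hs => by simp [hE0 s hs], s₀, ?_⟩
      simpa [hE1] using hlt
    · exact ⟨E g₀, hT, hE0, s₀, by simpa [hE1] using hgt⟩
  obtain ⟨m, hm, hmin⟩ := Finset.exists_min_image (Finset.univ.filter fun s => 0 < g s)
    (fun s => w s / g s) ⟨s₁, by simpa using hs₁⟩
  simp only [Finset.mem_filter, Finset.mem_univ, true_and] at hm hmin
  set t := w m / g m with ht
  have ht0 : 0 ≤ t := div_nonneg (hw m) hm.le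
  have hw1 : 0 ≤ w - t • g := by
    intro s
    simp only [Pi.zero_apply, Pi.sub_apply, Pi.smul_apply, smul_eq_mul, sub_nonneg]
    rcases lt_or_ge 0 (g s) with hg | hg
    · exact (le_div_iff₀ hg).1 (hmin s hg)
    · exact (mul_nonpos_of_nonneg_of_nonpos ht0 hg).trans (hw s)
  have hsupp : ∀ s, w s = 0 → (w - t • g) s = 0 := fun s hs => by simp [hs, hgw s hs]
  have hcard : (Finset.univ.filter fun s => (w - t • g) s ≠ 0).card < k := by
    rw [← h]
    apply Finset.card_lt_card
    rw [Finset.ssubset_iff_of_subset]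
    · refine ⟨m, ?_, ?_⟩
      · simp only [Finset.mem_filter, Finset.mem_univ, true_and]
        exact fun h0 => hm.ne' (hgw m h0)
      · simp [ht, div_mul_cancel₀ _ hm.ne']
    · intro s
      simp only [Finset.mem_filter, Finset.mem_univ, true_and]
      exact fun h1 h2 => h1 (hsupp s h2)
  obtain ⟨w', h1, h2, h3, h4⟩ := ih _ hcard (w - t • g) hw1 rfl
  exact ⟨w', h1, fun s hs => h2 s (hsupp s hs), by simp [h3, hTg], h4⟩

/-- A coupling may be replaced by one with the same marginals and the same integrals of finitely
many functions under which the second coordinate is almost a function of the first. -/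
theorem exists_coupling_almost_deterministic {X Y K : Type*} [Fintype X] [Fintype Y] [Fintype K]
    [DecidableEq X] [DecidableEq Y] [Nonempty Y] (l : X × Y → ℝ) (hl : 0 ≤ l)
    (A : Finset X) (B : Finset Y) (c : K → X × Y → ℝ) (r : ℝ) (hr : 0 ≤ r)
    (hA : ∀ x ∈ A, ∑ y, l (x, y) ≤ r) :
    ∃ l' : X × Y → ℝ, 0 ≤ l' ∧ (∀ s, l s = 0 → l' s = 0) ∧
      (∀ x, ∑ y, l' (x, y) = ∑ y, l (x, y)) ∧ (∀ y, ∑ x, l' (x, y) = ∑ x, l (x, y)) ∧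
      (∀ k, ∑ s, c k s * l' s = ∑ s, c k s * l s) ∧
      ∃ f : X → Y, ∑ s, (if s.2 = f s.1 then 0 else l' s) ≤
        ∑ s, (if s.1 ∈ A ∧ s.2 ∈ B then 0 else l s) +
          ((B.card : ℝ) + Fintype.card K) * r := by
  classical
  set w : X × Y → ℝ := fun s => if s.1 ∈ A ∧ s.2 ∈ B then l s else 0 with hw
  have hw0 : 0 ≤ w := fun s => by simp only [hw, Pi.zero_apply]; split_ifs; exacts [hl s, le_rfl]
  have hwl : ∀ s, w s ≤ l s := fun s => by simp only [hw]; split_ifs; exacts [le_rfl, hl s]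
  set A' := A.filter fun x => 0 < ∑ y, w (x, y) with hA'
  have hA'0 : ∀ x, x ∉ A' → ∀ y, w (x, y) = 0 := by
    intro x hx y
    by_cases hxA : x ∈ A
    · have h1 : ¬ 0 < ∑ y, w (x, y) := fun h => hx (Finset.mem_filter.2 ⟨hxA, h⟩)
      have h2 : ∑ y, w (x, y) = 0 :=
        le_antisymm (not_lt.1 h1) (Finset.sum_nonneg fun y _ => hw0 (x, y))
      exact (Finset.sum_eq_zero_iff_of_nonneg fun y _ => hw0 (x, y)).1 h2 y (Finset.mem_univ _)
    · simp [hw, hxA]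
  have hB0 : ∀ y, y ∉ B → ∀ x, w (x, y) = 0 := fun y hy x => by simp [hw, hy]
  let T : (X × Y → ℝ) →ₗ[ℝ] (A' ⊕ (B ⊕ K) → ℝ) :=
    LinearMap.pi (Sum.elim (fun x => ∑ y, LinearMap.proj (x.1, y))
      (Sum.elim (fun y => ∑ x, LinearMap.proj (x, y.1))
        (fun k => ∑ s, c k s • LinearMap.proj s)))
  obtain ⟨w', hw'0, hw's, hT, hcard⟩ := exists_small_support T w hw0
  rw [Module.finrank_fintype_fun_eq_card] at hcard
  simp only [Fintype.card_sum, Fintype.card_coe] at hcard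
  have hrow : ∀ x, ∑ y, w' (x, y) = ∑ y, w (x, y) := by
    intro x
    by_cases hx : x ∈ A'
    · simpa [T] using congrFun hT (Sum.inl ⟨x, hx⟩)
    · simp [hA'0 x hx, hw's _ (hA'0 x hx _)]
  have hcol : ∀ y, ∑ x, w' (x, y) = ∑ x, w (x, y) := by
    intro y
    by_cases hy : y ∈ B
    · simpa [T] using congrFun hT (Sum.inr (Sum.inl ⟨y, hy⟩))
    · simp [hB0 y hy, hw's _ (hB0 y hy _)]
  have hc : ∀ k, ∑ s, c k s * w' s = ∑ s, c k s * w s := fun k => by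
    simpa [T] using congrFun hT (Sum.inr (Sum.inr k))
  have hrr : ∀ x ∈ A', ∑ y, w' (x, y) ≤ r := fun x hx => by
    rw [hrow]
    exact (Finset.sum_le_sum fun y _ => hwl (x, y)).trans (hA x (Finset.mem_filter.1 hx).1)
  let F : X → Finset Y := fun x => Finset.univ.filter fun y => w' (x, y) ≠ 0
  obtain ⟨f, hf⟩ : ∃ f : X → Y, ∀ x, (F x).card ≤ 1 → ∀ y, w' (x, y) ≠ 0 → y = f x := by
    refine ⟨fun x => if h : (F x).Nonempty then h.choose else Classical.arbitrary Y,
      fun x hx y hy => ?_⟩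
    have hyF : y ∈ F x := by simp [F, hy]
    have hne : (F x).Nonempty := ⟨y, hyF⟩
    simp only [dif_pos hne]
    exact Finset.card_le_one.1 hx _ hyF _ hne.choose_spec
  set D := A'.filter fun x => 1 < (F x).card with hD
  have hDcard : D.card ≤ B.card + Fintype.card K := by
    have h1 : ∑ x ∈ A', (F x).card ≤ A'.card + (B.card + Fintype.card K) := by
      refine le_trans ?_ hcard
      rw [Finset.card_filter, Fintype.sum_prod_type]
      refine (Finset.sum_le_sum fun x _ => ?_).trans
        (Finset.sum_le_sum_of_subset (Finset.subset_univ A'))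
      simp [F, Finset.card_filter]
    have h2 : ∑ x ∈ A', (1 + if 1 < (F x).card then 1 else 0) ≤ ∑ x ∈ A', (F x).card := by
      refine Finset.sum_le_sum fun x hx => ?_
      have h3 : 0 < (F x).card := by
        rw [Finset.card_pos]
        by_contra hne
        have h4 : ∑ y, w' (x, y) = 0 := Finset.sum_eq_zero fun y _ => by
          by_contra h5
          exact hne ⟨y, by simp [F, h5]⟩
        rw [hrow] at h4
        exact (Finset.mem_filter.1 hx).2.ne' h4
      split_ifs <;> omega
    rw [Finset.sum_add_distrib, ← Finset.card_filter] at h2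
    simp only [Finset.sum_const, smul_eq_mul, mul_one] at h2
    change A'.card + D.card ≤ _ at h2
    omega
  refine ⟨l - w + w', ?_, ?_, ?_, ?_, ?_, f, ?_⟩
  · intro s
    have := hwl s
    have := hw'0 s
    simp only [Pi.zero_apply, Pi.add_apply, Pi.sub_apply] at *
    linarith
  · intro s hs
    have h0 : w s = 0 := le_antisymm (hs ▸ hwl s) (hw0 s)
    simp [hs, h0, hw's s h0]
  · intro x
    simp [Finset.sum_add_distrib, hrow]
  · intro y
    simp [Finset.sum_add_distrib, hcol]
  · intro k
    simp [Finset.sum_add_distrib, mul_add, mul_sub, hc]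
  · have h1 : ∑ s : X × Y, (if s.2 = f s.1 then 0 else w' s) ≤ D.card * r := by
      rw [Fintype.sum_prod_type, ← nsmul_eq_mul, ← Finset.sum_const]
      have h2 : ∀ x ∉ D, ∑ y, (if y = f x then 0 else w' (x, y)) = 0 := by
        intro x hx
        refine Finset.sum_eq_zero fun y _ => ?_
        split_ifs with hy
        · rfl
        by_contra h3
        have hxA : x ∈ A' := by
          by_contra h4
          exact h3 (hw's _ (hA'0 x h4 y))
        have h5 : (F x).card ≤ 1 := by
          by_contra h6
          exact hx (Finset.mem_filter.2 ⟨hxA, not_le.1 h6⟩)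
        exact hy (hf x h5 y h3)
      rw [← Finset.sum_subset (Finset.subset_univ D) fun x _ hx => h2 x hx]
      refine Finset.sum_le_sum fun x hx => ?_
      refine le_trans (Finset.sum_le_sum fun y _ => ?_) (hrr x (Finset.mem_filter.1 hx).1)
      split_ifs
      · exact hw'0 _
      · exact le_rfl
    have h2 : (D.card : ℝ) * r ≤ ((B.card : ℝ) + Fintype.card K) * r :=
      mul_le_mul_of_nonneg_right (by exact_mod_cast hDcard) hr
    have h3 : ∑ s : X × Y, (if s.2 = f s.1 then 0 else (l - w + w') s) ≤
        ∑ s : X × Y, (if s.1 ∈ A ∧ s.2 ∈ B then 0 else l s) +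
          ∑ s : X × Y, (if s.2 = f s.1 then 0 else w' s) := by
      rw [← Finset.sum_add_distrib]
      refine Finset.sum_le_sum fun s _ => ?_
      have := hw'0 s
      have := hl s
      simp only [Pi.zero_apply, Pi.add_apply, Pi.sub_apply, hw] at *
      split_ifs <;> simp <;> linarith
    linarith

/-- The shift on `ℤ → α`. -/
def shift {α : Type*} (ω : ℤ → α) : ℤ → α := fun i => ω (i + 1)

theorem shift_iterate {α : Type*} (k : ℕ) (ω : ℤ → α) : shift^[k] ω = fun i => ω (i + k) := by
  induction k generalizing ω with
  | zero => simp
  | succ k ih =>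
    rw [Function.iterate_succ_apply, ih]
    funext i
    simp only [shift, Nat.cast_succ]
    congr 1
    ring

section BernoulliShift

variable {α : Type*} [MeasurableSpace α]

/-- The `σ`-algebra on `ℤ → α` generated by the coordinates in `S`. -/
abbrev coordSigma (α : Type*) [MeasurableSpace α] (S : Set ℤ) : MeasurableSpace (ℤ → α) :=
  ⨆ i ∈ S, MeasurableSpace.comap (fun ω : ℤ → α => ω i) inferInstance

theorem coordSigma_le (S : Set ℤ) : coordSigma α S ≤ MeasurableSpace.pi :=
  iSup₂_le fun i _ => le_iSup (fun i => MeasurableSpace.comap (fun ω : ℤ → α => ω i) _) i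

theorem coordSigma_mono {S T : Set ℤ} (h : S ⊆ T) : coordSigma α S ≤ coordSigma α T :=
  biSup_mono h

theorem measurable_restrict_coordSigma (I : Finset ℤ) :
    Measurable[coordSigma α I] (I.restrict : (ℤ → α) → (I → α)) := by
  refine @measurable_pi_lambda _ _ _ (coordSigma α I) _ _ fun i => ?_
  exact measurable_iff_comap_le.2
    (le_biSup (fun i => MeasurableSpace.comap (fun ω : ℤ → α => ω i) _) i.2)

theorem measurableSet_coordSigma_of_dependsOn [Finite α] [MeasurableSingletonClass α]
    {I : Finset ℤ} {S : Set ℤ} (hI : (I : Set ℤ) ⊆ S) {E : Set (ℤ → α)}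
    (hE : ∀ ω ω' : ℤ → α, (∀ i ∈ I, ω i = ω' i) → ω ∈ E → ω' ∈ E) :
    MeasurableSet[coordSigma α S] E := by
  apply coordSigma_mono hI
  have h : E = I.restrict ⁻¹' (I.restrict '' E) := by
    refine Set.Subset.antisymm (Set.subset_preimage_image _ _) ?_
    rintro ω ⟨ω', h', he⟩
    exact hE ω' ω (fun i hi => congrFun he ⟨i, hi⟩) h'
  rw [h]
  exact measurable_restrict_coordSigma I (Set.toFinite _).measurableSet

variable (m : Measure α) [IsProbabilityMeasure m]

/-- The law of the i.i.d. sequence indexed by `ℤ` with one-site law `m`. -/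
noncomputable abbrev iidMeasure : Measure (ℤ → α) := Measure.infinitePi fun _ : ℤ => m

theorem iidMeasure_inter {S T : Set ℤ} (hST : Disjoint S T) {E F : Set (ℤ → α)}
    (hE : MeasurableSet[coordSigma α S] E) (hF : MeasurableSet[coordSigma α T] F) :
    (iidMeasure m) (E ∩ F) = iidMeasure m E * iidMeasure m F := by
  have h : iIndepFun (fun (i : ℤ) (ω : ℤ → α) => ω i) (iidMeasure m) :=
    iIndepFun_infinitePi (X := fun _ ω => ω) fun _ => measurable_id
  have h' := indep_iSup_of_disjoint (fun i => (measurable_pi_apply i).comap_le) h hST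
  exact (Indep_iff _ _ _).1 h' E F hE hF

theorem measurable_shift : Measurable (shift : (ℤ → α) → (ℤ → α)) :=
  measurable_pi_lambda _ fun i => measurable_pi_apply (i + 1)

theorem measurePreserving_shift : MeasurePreserving shift (iidMeasure m) (iidMeasure m) :=
  ⟨measurable_shift, Measure.map_infinitePi_infinitePi_of_inj (P := fun _ : ℤ => m)
    (f := fun i : ℤ => i + 1) (add_left_injective 1)⟩

theorem ergodic_shift : Ergodic shift (iidMeasure m) := by
  refine ⟨measurePreserving_shift m, ⟨fun s hs hinv => ?_⟩⟩
  set P := iidMeasure m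
  have key : ∀ ε > 0, |P.real s - P.real s * P.real s| ≤ 4 * ε := by
    intro ε hε
    obtain ⟨t, ht, hts⟩ := exists_measure_symmDiff_lt_of_generateFrom_isSetRing (μ := P)
      (isSetRing_measurableCylinders (α := fun _ : ℤ => α))
      ⟨{Set.univ}, Set.countable_singleton _,
        by simpa using univ_mem_measurableCylinders (fun _ : ℤ => α), by simp⟩
      generateFrom_measurableCylinders.symm hs (ε := ENNReal.ofReal ε) (by simpa using hε)
    obtain ⟨I, S, hS, rfl⟩ := (mem_measurableCylinders _).1 ht
    set t : Set (ℤ → α) := cylinder (α := fun _ : ℤ => α) I S with ht_def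
    obtain ⟨b, hb⟩ : ∃ b : ℕ, ∀ i ∈ I, |i| ≤ b := by
      refine ⟨∑ i ∈ I, i.natAbs, fun i hi => ?_⟩
      have := Finset.single_le_sum (f := fun i : ℤ => i.natAbs) (fun _ _ => Nat.zero_le _) hi
      change i.natAbs ≤ ∑ i ∈ I, i.natAbs at this
      rw [Int.abs_eq_natAbs]
      exact_mod_cast this
    let k := 2 * b + 1
    let J : Finset ℤ := I.image fun i => i + k
    have htm : MeasurableSet t := MeasurableSet.cylinder I hS
    have htI : MeasurableSet[coordSigma α I] t := measurable_restrict_coordSigma I hS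
    have hmpk := (measurePreserving_shift m).iterate k
    have htJ : MeasurableSet[coordSigma α J] (shift^[k] ⁻¹' t) := by
      have hme : Measurable[coordSigma α J] (fun ω : ℤ → α => fun i : I => ω (i + k)) := by
        refine @measurable_pi_lambda _ _ _ (coordSigma α J) _ _ fun i => ?_
        refine measurable_iff_comap_le.2
          (le_biSup (fun i => MeasurableSpace.comap (fun ω : ℤ → α => ω i) _)
            (?_ : (i : ℤ) + k ∈ (J : Set ℤ)))
        simp only [J, Finset.coe_image]
        exact ⟨i, i.2, rfl⟩
      have : shift^[k] ⁻¹' t = (fun ω : ℤ → α => fun i : I => ω (i + k)) ⁻¹' S := by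
        ext ω
        simp only [Set.mem_preimage, shift_iterate, t, mem_cylinder]
        rfl
      rw [this]
      exact hme hS
    have hdisj : Disjoint (I : Set ℤ) (J : Set ℤ) := by
      rw [Finset.disjoint_coe, Finset.disjoint_left]
      intro i hi hj
      simp only [J, Finset.mem_image] at hj
      obtain ⟨j, hj, hij⟩ := hj
      have h1 := abs_le.1 (hb i hi)
      have h2 := abs_le.1 (hb j hj)
      simp only [k] at hij
      push_cast at hij
      omega
    have hmul : P.real (t ∩ shift^[k] ⁻¹' t) = P.real t * P.real t := by
      rw [measureReal_def, iidMeasure_inter m hdisj htI htJ, ENNReal.toReal_mul,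
        hmpk.measure_preimage htm.nullMeasurableSet]
      rfl
    have hsk : shift^[k] ⁻¹' s = s := by
      rw [Set.preimage_iterate_eq]
      exact Function.iterate_fixed hinv k
    have hd1 : P.real (symmDiff t s) ≤ ε := by
      rw [measureReal_def]
      exact ENNReal.toReal_le_of_le_ofReal hε.le hts.le
    have hd2 : P.real (symmDiff (shift^[k] ⁻¹' t) s) ≤ ε := by
      have : symmDiff (shift^[k] ⁻¹' t) s = shift^[k] ⁻¹' (symmDiff t s) := by
        conv_lhs => rw [← hsk]
        rfl
      rw [this, measureReal_def,
        hmpk.measure_preimage (htm.symmDiff hs).nullMeasurableSet]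
      exact hd1
    have hd3 : P.real (symmDiff (t ∩ shift^[k] ⁻¹' t) s) ≤ 2 * ε := by
      refine (measureReal_mono ?_ (by finiteness)).trans
        ((measureReal_union_le (symmDiff t s) (symmDiff (shift^[k] ⁻¹' t) s)).trans (by linarith))
      intro ω
      simp only [Set.mem_symmDiff, Set.mem_inter_iff, Set.mem_union]
      tauto
    have he1 := (abs_measureReal_sub_le_measureReal_symmDiff (μ := P) htm.nullMeasurableSet
      hs.nullMeasurableSet).trans hd1
    have htk : MeasurableSet (shift^[k] ⁻¹' t) := hmpk.measurable htm
    have he2 := (abs_measureReal_sub_le_measureReal_symmDiff (μ := P)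
      (htm.inter htk).nullMeasurableSet hs.nullMeasurableSet).trans hd3
    rw [hmul] at he2
    have h1 : 0 ≤ P.real t := measureReal_nonneg
    have h2 : P.real t ≤ 1 := measureReal_le_one
    have h3 : 0 ≤ P.real s := measureReal_nonneg
    have h4 : P.real s ≤ 1 := measureReal_le_one
    have h5 : |P.real t * P.real t - P.real s * P.real s| ≤ 2 * ε := by
      rw [show P.real t * P.real t - P.real s * P.real s
        = (P.real t + P.real s) * (P.real t - P.real s) by ring, abs_mul,
        abs_of_nonneg (by positivity)]
      exact mul_le_mul (by linarith) he1 (abs_nonneg _) (by norm_num)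
    rw [abs_le] at he2 h5 ⊢
    constructor <;> linarith [he2.1, he2.2, h5.1, h5.2]
  have h0 : P.real s = P.real s * P.real s := by
    by_contra hne
    have hpos : 0 < |P.real s - P.real s * P.real s| := abs_pos.2 (sub_ne_zero.2 hne)
    have := key (|P.real s - P.real s * P.real s| / 8) (by positivity)
    linarith
  rw [eventuallyConst_set']
  have h01 : P.real s = 0 ∨ P.real s = 1 := by
    rcases eq_or_ne (P.real s) 0 with h | h
    · exact Or.inl h
    · right
      exact (mul_left_cancel₀ h (by rw [← h0, mul_one])).symm
  rcases h01 with h | h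
  · left
    exact ae_eq_empty.2 ((measureReal_eq_zero_iff (by finiteness)).1 h)
  · right
    rw [ae_eq_univ]
    exact (prob_compl_eq_zero_iff hs).2 (by
      rw [← ENNReal.toReal_eq_one_iff]; exact h)

end BernoulliShift

section FiniteLaw

variable {A : Type*} [Fintype A] [MeasurableSpace A]

/-- The measure on a finite type with point masses `w`. -/
noncomputable def finLaw (w : A → ℝ) : Measure A :=
  ∑ a, ENNReal.ofReal (w a) • Measure.dirac a

theorem finLaw_singleton [MeasurableSingletonClass A] (w : A → ℝ) (a : A) :
    finLaw w {a} = ENNReal.ofReal (w a) := by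
  classical
  simp only [finLaw, Measure.coe_finsetSum, Finset.sum_apply, Measure.smul_apply,
    Measure.dirac_apply, smul_eq_mul, Set.indicator_apply, Set.mem_singleton_iff, Pi.one_apply]
  simp

theorem isProbabilityMeasure_finLaw {w : A → ℝ} (hw0 : ∀ a, 0 ≤ w a) (hw1 : ∑ a, w a = 1) :
    IsProbabilityMeasure (finLaw w) := by
  constructor
  simp only [finLaw, Measure.coe_finsetSum, Finset.sum_apply, Measure.smul_apply,
    measure_univ, smul_eq_mul, mul_one]
  rw [← ENNReal.ofReal_sum_of_nonneg fun a _ => hw0 a, hw1, ENNReal.ofReal_one]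

theorem measure_eq_sum_singleton [MeasurableSingletonClass A] [DecidableEq A] (P : Measure A)
    (s : Set A) [DecidablePred (· ∈ s)] :
    P s = ∑ a, if a ∈ s then P {a} else 0 := by
  rw [← Finset.sum_filter, sum_measure_singleton]
  simp

end FiniteLaw

/-- A coupling of finitely supported laws is realised by a random map. -/
theorem exists_random_map {A B : Type*} [Fintype A] [Fintype B] [Nonempty B] [MeasurableSpace B]
    [MeasurableSingletonClass B] (l : A → B → ℝ) (hl : ∀ a b, 0 ≤ l a b) :
    ∃ κ : Measure (A → B), IsProbabilityMeasure κ ∧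
      ∀ a b, ENNReal.ofReal (∑ b', l a b') * κ {φ | φ a = b} = ENNReal.ofReal (l a b) := by
  classical
  let w : A → B → ℝ := fun a b =>
    if ∑ b', l a b' = 0 then (if b = Classical.arbitrary B then 1 else 0)
    else l a b / ∑ b', l a b'
  have hw0 : ∀ a b, 0 ≤ w a b := by
    intro a b
    simp only [w]
    split_ifs
    · exact zero_le_one
    · exact le_rfl
    · exact div_nonneg (hl a b) (Finset.sum_nonneg fun b _ => hl a b)
  have hw1 : ∀ a, ∑ b, w a b = 1 := by
    intro a
    by_cases h : ∑ b', l a b' = 0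
    · simp [w, h]
    · simp only [w, h, if_false]
      rw [← Finset.sum_div, div_self h]
  have hprob : ∀ a, IsProbabilityMeasure (finLaw (w a)) := fun a =>
    isProbabilityMeasure_finLaw (hw0 a) (hw1 a)
  refine ⟨Measure.pi fun a => finLaw (w a), inferInstance, fun a b => ?_⟩
  have h1 : (Measure.pi fun a => finLaw (w a)) {φ | φ a = b} = ENNReal.ofReal (w a b) := by
    have := (measurePreserving_eval (fun a => finLaw (w a)) a).measure_preimage
      (measurableSet_singleton b).nullMeasurableSet
    rw [finLaw_singleton] at this
    exact this
  rw [h1, ← ENNReal.ofReal_mul (Finset.sum_nonneg fun b _ => hl a b)]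
  congr 1
  by_cases h : ∑ b', l a b' = 0
  · rw [h, zero_mul]
    exact ((Finset.sum_eq_zero_iff_of_nonneg fun b _ => hl a b).1 h b (Finset.mem_univ _)).symm
  · simp only [w, h, if_false]
    field_simp


section Bernoulli

variable {N : ℕ} {p : Fin N → ℝ}

theorem isBernoulli_eq_iidMeasure (hp0 : ∀ i, 0 ≤ p i) (hp1 : ∑ i, p i = 1)
    {μ : Measure (ℤ → Fin N)} (hμ : IsBernoulli p μ) :
    haveI := isProbabilityMeasure_finLaw hp0 hp1
    μ = iidMeasure (finLaw p) := by
  have := isProbabilityMeasure_finLaw hp0 hp1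
  have := hμ.1
  refine (Measure.isProjectiveLimit_infinitePi fun _ : ℤ => finLaw p).unique ?_ |>.symm
  intro s
  have : IsProbabilityMeasure (μ.map s.restrict) :=
    Measure.isProbabilityMeasure_map (Finset.measurable_restrict s).aemeasurable
  refine Measure.ext_of_singleton fun f => ?_
  rw [Measure.map_apply (Finset.measurable_restrict s) (measurableSet_singleton f),
    Measure.pi_singleton]
  have : Nonempty (Fin N) := by
    by_contra h
    rw [not_nonempty_iff] at h
    simp at hp1
  classical
  let g : ℤ → Fin N := fun i => if h : i ∈ s then f ⟨i, h⟩ else Classical.arbitrary _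
  have h1 : s.restrict ⁻¹' ({f} : Set (s → Fin N)) = {x | ∀ i ∈ s, x i = g i} := by
    ext x
    simp only [Set.mem_preimage, Set.mem_singleton_iff, Set.mem_ofPred_eq, funext_iff,
      Subtype.forall, Finset.restrict]
    refine forall₂_congr fun i hi => ?_
    simp [g, hi]
  rw [h1, hμ.2 s g, ← Finset.prod_attach]
  refine Finset.prod_congr rfl fun i _ => ?_
  rw [finLaw_singleton]
  simp [g]

theorem prod_pos_iff_ae (hp0 : ∀ i, 0 ≤ p i) (hp1 : ∑ i, p i = 1) :
    haveI := isProbabilityMeasure_finLaw hp0 hp1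
    ∀ᵐ x ∂(iidMeasure (finLaw p)), ∀ i : ℤ, 0 < p (x i) := by
  have := isProbabilityMeasure_finLaw hp0 hp1
  rw [ae_all_iff]
  intro i
  have h : ∀ᵐ a ∂(finLaw p), 0 < p a := by
    rw [ae_iff]
    classical
    rw [measure_eq_sum_singleton]
    refine Finset.sum_eq_zero fun a _ => ?_
    split_ifs with ha
    · rw [finLaw_singleton, ENNReal.ofReal_eq_zero]
      exact not_lt.1 ha
    · rfl
  exact (measurePreserving_eval_infinitePi (fun _ : ℤ => finLaw p) i).quasiMeasurePreserving.ae h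

theorem integral_finLaw (hp0 : ∀ i, 0 ≤ p i) (hp1 : ∑ i, p i = 1) (g : Fin N → ℝ) :
    ∫ a, g a ∂(finLaw p) = ∑ a, p a * g a := by
  have := isProbabilityMeasure_finLaw hp0 hp1
  rw [integral_fintype (Integrable.of_finite)]
  refine Finset.sum_congr rfl fun a _ => ?_
  rw [measureReal_def, finLaw_singleton, ENNReal.toReal_ofReal (hp0 a), smul_eq_mul]

/-- The asymptotic equipartition property of a Bernoulli measure. -/
theorem tendsto_measure_not_typical (hp0 : ∀ i, 0 ≤ p i) (hp1 : ∑ i, p i = 1) {η : ℝ}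
    (hη : 0 < η) :
    haveI := isProbabilityMeasure_finLaw hp0 hp1
    Tendsto (fun n : ℕ => iidMeasure (finLaw p) {x | ¬ (
      Real.exp (-(n * (shannonH p + η))) ≤ ∏ i ∈ Finset.range n, p (x i) ∧
      ∏ i ∈ Finset.range n, p (x i) ≤ Real.exp (-(n * (shannonH p - η))))}) atTop (𝓝 0) := by
  have := isProbabilityMeasure_finLaw hp0 hp1
  set P := iidMeasure (finLaw p)
  let Z : ℕ → (ℤ → Fin N) → ℝ := fun i x => Real.log (p (x i))
  have hg : Measurable fun a : Fin N => Real.log (p a) := measurable_of_finite _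
  have hZm : ∀ i, Measurable (Z i) := fun i => hg.comp (measurable_pi_apply _)
  have hev : ∀ i : ℤ, MeasurePreserving (fun x : ℤ → Fin N => x i) P (finLaw p) := fun i =>
    measurePreserving_eval_infinitePi (fun _ : ℤ => finLaw p) i
  have hint : Integrable (Z 0) P :=
    (hev _).integrable_comp_of_integrable (g := fun a => Real.log (p a)) Integrable.of_finite
  have hind : iIndepFun (fun (i : ℤ) (x : ℤ → Fin N) => Real.log (p (x i))) P :=
    iIndepFun_infinitePi (X := fun _ a => Real.log (p a)) fun _ => hg
  have hslln := strong_law_ae_real Z hint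
    (fun i j hij => hind.indepFun (by exact_mod_cast hij)) (fun i => by
      refine ⟨(hZm i).aemeasurable, (hZm 0).aemeasurable, ?_⟩
      have h1 : ∀ i : ℤ, P.map (fun x => Real.log (p (x i))) =
          (finLaw p).map fun a => Real.log (p a) := fun i => by
        rw [← (hev i).map_eq, Measure.map_map hg (hev i).measurable]
        rfl
      exact (h1 _).trans (h1 _).symm)
  have hmean : ∫ x, Z 0 x ∂P = - shannonH p := by
    have h1 : ∫ x, Z 0 x ∂P = ∫ a, Real.log (p a) ∂(finLaw p) := by
      rw [← (hev ((0 : ℕ) : ℤ)).map_eq, integral_map (hev _).aemeasurable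
        hg.aestronglyMeasurable]
    rw [h1, integral_finLaw hp0 hp1, shannonH, neg_neg]
  rw [hmean] at hslln
  have hconv := tendstoInMeasure_of_tendsto_ae (μ := P)
    (f := fun n x => (∑ i ∈ Finset.range n, Z i x) / n) (g := fun _ => -shannonH p)
    (fun n => by
      have : Measurable fun x => (∑ i ∈ Finset.range n, Z i x) / n :=
        (Finset.measurable_sum _ fun i _ => hZm i).div_const _
      exact this.aestronglyMeasurable) hslln (ENNReal.ofReal η) (by simpa using hη)
  refine tendsto_of_tendsto_of_tendsto_of_le_of_le' tendsto_const_nhds hconv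
    (Eventually.of_forall fun _ => zero_le) ?_
  filter_upwards [eventually_gt_atTop 0] with n hn
  refine measure_mono_ae ?_
  filter_upwards [prod_pos_iff_ae hp0 hp1] with x hx hxn
  have hn' : (0 : ℝ) < n := by exact_mod_cast hn
  by_contra hlt
  apply hxn
  have hlt' : |(∑ i ∈ Finset.range n, Z i x) / n + shannonH p| < η := by
    have h2 : ¬ ENNReal.ofReal η ≤ edist ((∑ i ∈ Finset.range n, Z i x) / n) (-shannonH p) := hlt
    rw [not_le, edist_dist, ENNReal.ofReal_lt_ofReal_iff hη, Real.dist_eq, sub_neg_eq_add] at h2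
    exact h2
  rw [abs_lt] at hlt'
  have hprod : ∏ i ∈ Finset.range n, p (x i) = Real.exp (∑ i ∈ Finset.range n, Z i x) := by
    rw [Real.exp_sum]
    exact Finset.prod_congr rfl fun i _ => (Real.exp_log (hx i)).symm
  have hdiv : (∑ i ∈ Finset.range n, Z i x) = n * ((∑ i ∈ Finset.range n, Z i x) / n) := by
    field_simp
  rw [hprod, Real.exp_le_exp, Real.exp_le_exp, hdiv]
  constructor <;> nlinarith

end Bernoulli

section Parsing

variable {N : ℕ} (a : Fin N) (n : ℕ)

/-- One step of the parser. State `0` scans for the marker `a`; a positive state is the number of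
sites left in the current block of length `n`. -/
def step (j : ℕ) (b : Fin N) : ℕ := if j = 0 then (if b = a then n else 0) else j - 1

/-- The state of the parser after reading `k` letters of `x` from site `s` on, scanning at `s`. -/
def run (x : ℤ → Fin N) (s : ℤ) : ℕ → ℕ
  | 0 => 0
  | k + 1 => step a n (run x s k) (x (s + k))

/-- The state at site `t` of the parser started at `-∞`. -/
noncomputable def parse (x : ℤ → Fin N) (t : ℤ) : ℕ :=
  limUnder atTop fun T : ℕ => run a n x (t - T) T

/-- No marker occurs in the `n` sites preceding `r`. -/
def IsReset (x : ℤ → Fin N) (r : ℤ) : Prop := ∀ i ∈ Finset.Ico (r - n) r, x i ≠ a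

/-- Resets occur arbitrarily far in the past. -/
def IsParsable (x : ℤ → Fin N) : Prop := ∀ t, ∃ r ≤ t, IsReset a n x r

variable {a n} {x : ℤ → Fin N}

theorem step_le {j : ℕ} (hj : j ≤ n) (b : Fin N) : step a n j b ≤ n := by
  unfold step
  split_ifs <;> omega

theorem run_le (s : ℤ) (k : ℕ) : run a n x s k ≤ n := by
  induction k with
  | zero => exact Nat.zero_le n
  | succ k ih => exact step_le ih _

theorem run_add {s : ℤ} {k : ℕ} (h : run a n x s k = 0) (l : ℕ) :
    run a n x s (k + l) = run a n x (s + k) l := by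
  induction l with
  | zero => exact h
  | succ l ih =>
    change step a n (run a n x s (k + l)) (x (s + (k + l : ℕ))) = step a n _ (x (s + k + l))
    rw [ih]
    push_cast
    rw [add_assoc]

theorem run_congr {x' : ℤ → Fin N} {s : ℤ} {k : ℕ} (h : ∀ i ∈ Finset.Ico s (s + k), x i = x' i) :
    run a n x s k = run a n x' s k := by
  induction k with
  | zero => rfl
  | succ k ih =>
    change step a n _ _ = step a n _ _
    rw [ih fun i hi => h i (by simp only [Finset.mem_Ico] at *; push_cast; omega),
      h (s + k) (by simp)]

theorem run_eq_zero_of_isReset {s : ℤ} {K : ℕ} (hr : IsReset a n x (s + K)) :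
    run a n x s K = 0 := by
  have key : ∀ k ≤ K, K - n ≤ k → run a n x s k ≤ K - k := by
    intro k
    induction k with
    | zero => intro _ _; exact Nat.zero_le _
    | succ k ih =>
      intro hk hkn
      by_cases hkn' : K - n ≤ k
      · have h1 := ih (by omega) hkn'
        have h2 : x (s + k) ≠ a := hr _ (by simp only [Finset.mem_Ico]; omega)
        change step a n _ _ ≤ _
        unfold step
        rw [if_neg h2]
        split_ifs <;> omega
      · exact (run_le s (k + 1)).trans (by omega)
  have := key K le_rfl (by omega)
  omega

theorem run_shift (s : ℤ) (k : ℕ) : run a n (shift x) s k = run a n x (s + 1) k := by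
  induction k with
  | zero => rfl
  | succ k ih =>
    change step a n _ _ = step a n _ _
    rw [ih]
    simp only [shift]
    rw [add_right_comm]

theorem parse_shift (t : ℤ) : parse a n (shift x) t = parse a n x (t + 1) := by
  simp only [parse, run_shift]
  congr! 3
  ring

theorem IsParsable.eventually_run_eq (hx : IsParsable a n x) (t : ℤ) :
    ∀ᶠ T : ℕ in atTop, run a n x (t - T) T = parse a n x t := by
  obtain ⟨r, hrt, hr⟩ := hx t
  obtain ⟨l, rfl⟩ := Int.le.dest hrt
  have h : ∀ᶠ T : ℕ in atTop, run a n x (r + l - T) T = run a n x r l := by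
    filter_upwards [eventually_ge_atTop l] with T hT
    obtain ⟨K, rfl⟩ := Nat.exists_eq_add_of_le' hT
    have h1 : r + l - (K + l : ℕ) + K = r := by push_cast; ring
    rw [run_add (run_eq_zero_of_isReset (by rwa [h1])), h1]
  have h2 : parse a n x (r + l) = run a n x r l :=
    (tendsto_nhds_of_eventually_eq h).limUnder_eq
  rwa [h2]

theorem IsParsable.parse_le (hx : IsParsable a n x) (t : ℤ) : parse a n x t ≤ n := by
  obtain ⟨T, hT⟩ := (hx.eventually_run_eq t).exists
  exact hT ▸ run_le _ _

theorem IsParsable.parse_succ (hx : IsParsable a n x) (t : ℤ) :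
    parse a n x (t + 1) = step a n (parse a n x t) (x t) := by
  obtain ⟨T, hT1, hT2⟩ := ((hx.eventually_run_eq t).and
    ((tendsto_add_atTop_nat 1).eventually (hx.eventually_run_eq (t + 1)))).exists
  rw [← hT2, ← hT1]
  have h1 : t + 1 - (T + 1 : ℕ) = t - T := by push_cast; ring
  rw [h1]
  change step a n _ _ = _
  rw [sub_add_cancel]

theorem IsParsable.parse_add (hx : IsParsable a n x) {s : ℤ} (hs : parse a n x s = n) {l : ℕ}
    (hl : l ≤ n) : parse a n x (s + l) = n - l := by
  induction l with
  | zero => simpa using hs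
  | succ l ih =>
    have h1 : s + (l + 1 : ℕ) = s + l + 1 := by push_cast; ring
    rw [h1, hx.parse_succ, ih (by omega), step, if_neg (by omega)]
    omega

theorem IsParsable.parse_sub (hx : IsParsable a n x) {t : ℤ} {j : ℕ} (hj : 0 < j) :
    ∀ l : ℕ, j + l = n → parse a n x t = j → parse a n x (t - l) = n := by
  intro l
  induction l generalizing t j with
  | zero => intro h1 h2; simpa [← h1] using h2
  | succ l ih =>
    intro h1 h2
    have h3 := hx.parse_succ (t - 1)
    rw [sub_add_cancel, h2, step] at h3
    have h4 : parse a n x (t - 1) = j + 1 := by split_ifs at h3 <;> omega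
    have h5 := ih (Nat.succ_pos j) (by omega) h4
    rwa [show t - (l + 1 : ℕ) = t - 1 - l by push_cast; ring]

end Parsing

section Measurability

variable {N : ℕ} {a : Fin N} {n : ℕ} {Ω : Type*} [Finite Ω] [MeasurableSpace Ω]
  [MeasurableSingletonClass Ω] (pr : Ω → Fin N)

theorem measurable_run (s : ℤ) (k : ℕ) :
    Measurable[coordSigma Ω (Finset.Ico s (s + k))] fun ω : ℤ → Ω => run a n (pr ∘ ω) s k := by
  refine @measurable_to_countable' _ _ _ _ (coordSigma Ω (Finset.Ico s (s + k))) _ fun j => ?_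
  refine measurableSet_coordSigma_of_dependsOn le_rfl fun ω ω' h hω => ?_
  have h1 : run a n (pr ∘ ω) s k = run a n (pr ∘ ω') s k :=
    run_congr fun i hi => congrArg pr (h i hi)
  exact h1.symm.trans hω

theorem measurable_limUnder_nat {X : Type*} [MeasurableSpace X] {f : ℕ → X → ℕ}
    (hf : ∀ T, Measurable (f T)) : Measurable fun x => limUnder atTop fun T => f T x :=
  (StronglyMeasurable.limUnder fun T => (hf T).stronglyMeasurable).measurable

theorem measurable_parse (t : ℤ) :
    Measurable[coordSigma Ω (Set.Iio t)] fun ω : ℤ → Ω => parse a n (pr ∘ ω) t := by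
  have h : ∀ T : ℕ, Measurable[coordSigma Ω (Set.Iio t)]
      fun ω : ℤ → Ω => run a n (pr ∘ ω) (t - T) T := fun T =>
    (measurable_run pr (t - T) T).mono (coordSigma_mono (by intro i; simp)) le_rfl
  exact @measurable_limUnder_nat _ (coordSigma Ω (Set.Iio t)) _ h

end Measurability

/-- The word of length `n` of `x` starting at `s`. -/
def blockAt (n : ℕ) {α : Type*} (x : ℤ → α) (s : ℤ) : Fin n → α := fun i => x (s + i)

theorem run_marker {N : ℕ} {a : Fin N} {n : ℕ} {x : ℤ → Fin N} {s : ℤ} (hs : x s = a) {i : ℕ}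
    (hi : i ≤ n) : run a n x s (1 + i) = n - i := by
  induction i with
  | zero => simp [run, step, hs]
  | succ i ih =>
    change step a n (run a n x s (1 + i)) _ = _
    rw [ih (by omega), step, if_neg (by omega)]
    omega

theorem run_one_of_ne {N : ℕ} {a : Fin N} {n : ℕ} {x : ℤ → Fin N} {s : ℤ} (hs : x s ≠ a) :
    run a n x s 1 = 0 := by
  simp [run, step, hs]

/-- A block code: each site carries a letter, an output letter used while scanning for the
marker, and a map producing the output on a block of length `n` starting at this site. -/
structure BlockCode (N n : ℕ) (Ω : Type*) where
  /-- The marker. -/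
  marker : Fin N
  /-- The input letter. -/
  letter : Ω → Fin N
  /-- The output letter outside of the blocks. -/
  scan : Ω → Fin N
  /-- The output inside of a block. -/
  block : Ω → (Fin n → Fin N) → (Fin n → Fin N)

namespace BlockCode

variable {N n : ℕ} {Ω : Type*} (c : BlockCode N n Ω)

/-- The input sequence. -/
def input (ω : ℤ → Ω) : ℤ → Fin N := c.letter ∘ ω

/-- The output on the block starting at `s`. -/
def blockOut (ω : ℤ → Ω) (s : ℤ) : Fin n → Fin N := c.block (ω s) (blockAt n (c.input ω) s)

/-- The output at site `t` when the parser is in state `j`. -/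
def out (ω : ℤ → Ω) (t : ℤ) (j : ℕ) : Fin N :=
  if h : 0 < j ∧ j ≤ n then c.blockOut ω (t - (n - j : ℕ)) ⟨n - j, by omega⟩ else c.scan (ω t)

/-- The output sequence. -/
noncomputable def output (ω : ℤ → Ω) : ℤ → Fin N :=
  fun t => c.out ω t (parse c.marker n (c.input ω) t)

variable {c} in
theorem out_zero (ω : ℤ → Ω) (t : ℤ) : c.out ω t 0 = c.scan (ω t) := by
  simp [out]

variable {c} in
theorem out_block (ω : ℤ → Ω) (s : ℤ) (i : Fin n) :
    c.out ω (s + i) (n - i) = c.blockOut ω s i := by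
  have h : n - (n - (i : ℕ)) = i := by omega
  rw [out, dif_pos (by omega)]
  simp only [h, add_sub_cancel_right]

theorem input_shift (ω : ℤ → Ω) : c.input (shift ω) = shift (c.input ω) := rfl

theorem blockOut_shift (ω : ℤ → Ω) (s : ℤ) : c.blockOut (shift ω) s = c.blockOut ω (s + 1) := by
  have h : blockAt n (c.input (shift ω)) s = blockAt n (c.input ω) (s + 1) := by
    funext i
    simp only [input_shift, blockAt, shift, add_right_comm]
  rw [blockOut, h]
  rfl

theorem output_shift (ω : ℤ → Ω) : c.output (shift ω) = shift (c.output ω) := by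
  funext t
  simp only [output, input_shift, parse_shift, shift, out, blockOut_shift, sub_add_eq_add_sub]

/-- The output of the parser started at `s` meets the constraints `t`. -/
def Meets (s : ℤ) (t : ℕ → Set (Fin N)) : Set (ℤ → Ω) :=
  {ω | ∀ i : ℕ, c.out ω (s + i) (run c.marker n (c.input ω) s i) ∈ t i}

theorem meets_eq (s : ℤ) (t : ℕ → Set (Fin N)) :
    c.Meets s t = ({ω | c.letter (ω s) = c.marker ∧ c.scan (ω s) ∈ t 0} ∩
        {ω | ∀ i : Fin n, c.blockOut ω (s + 1) i ∈ t (1 + i)} ∩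
        c.Meets (s + (1 + n : ℕ)) fun i => t (1 + n + i)) ∪
      ({ω | c.letter (ω s) ≠ c.marker ∧ c.scan (ω s) ∈ t 0} ∩
        c.Meets (s + 1) fun i => t (1 + i)) := by
  have h0 : ∀ ω, c.out ω (s + (0 : ℕ)) (run c.marker n (c.input ω) s 0) = c.scan (ω s) := by
    intro ω
    rw [run, out_zero]
    simp
  ext ω
  simp only [Set.mem_union, Set.mem_inter_iff, Set.mem_ofPred_eq, Meets]
  by_cases hs : c.letter (ω s) = c.marker
  · have h1 : ∀ i : Fin n, c.out ω (s + (1 + i : ℕ))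
        (run c.marker n (c.input ω) s (1 + i)) = c.blockOut ω (s + 1) i := by
      intro i
      rw [run_marker hs i.2.le, ← out_block]
      push_cast
      rw [add_assoc]
    have h2 : ∀ i : ℕ, c.out ω (s + (1 + n + i : ℕ))
        (run c.marker n (c.input ω) s (1 + n + i)) = c.out ω (s + (1 + n : ℕ) + i)
          (run c.marker n (c.input ω) (s + (1 + n : ℕ)) i) := by
      intro i
      rw [run_add (by simpa using run_marker hs le_rfl)]
      push_cast
      simp only [add_assoc]
    simp only [hs, ne_eq, not_true_eq_false, false_and, or_false, true_and]
    constructor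
    · intro h
      exact ⟨⟨h0 ω ▸ h 0, fun i => h1 i ▸ h _⟩, fun i => h2 i ▸ h _⟩
    · rintro ⟨⟨h3, h4⟩, h5⟩ i
      rcases Nat.eq_zero_or_pos i with rfl | hi
      · exact (h0 ω).symm ▸ h3
      · obtain ⟨j, rfl⟩ := Nat.exists_eq_add_of_le hi
        rcases lt_or_ge j n with hj | hj
        · exact (h1 ⟨j, hj⟩).symm ▸ h4 ⟨j, hj⟩
        · obtain ⟨l, rfl⟩ := Nat.exists_eq_add_of_le hj
          have := h2 l ▸ h5 l
          rwa [add_assoc 1 n l] at this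
  · have h1 : ∀ i : ℕ, c.out ω (s + (1 + i : ℕ))
        (run c.marker n (c.input ω) s (1 + i)) = c.out ω (s + 1 + i)
          (run c.marker n (c.input ω) (s + 1) i) := by
      intro i
      rw [run_add (run_one_of_ne hs)]
      push_cast
      simp only [add_assoc]
    simp only [hs, ne_eq, not_false_eq_true, false_and, false_or, true_and]
    constructor
    · intro h
      exact ⟨h0 ω ▸ h 0, fun i => h1 i ▸ h _⟩
    · rintro ⟨h3, h5⟩ i
      rcases Nat.eq_zero_or_pos i with rfl | hi
      · exact (h0 ω).symm ▸ h3
      · obtain ⟨j, rfl⟩ := Nat.exists_eq_add_of_le hi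
        exact (h1 j).symm ▸ h5 j

section Law

variable [Finite Ω] [MeasurableSpace Ω] [MeasurableSingletonClass Ω]
  {m : Measure Ω} [IsProbabilityMeasure m] {Q : Measure (Fin N)} [IsProbabilityMeasure Q]

variable {c}

theorem measurableSet_site (s : ℤ) (E : Set Ω) {S : Set ℤ} (hs : s ∈ S) :
    MeasurableSet[coordSigma Ω S] {ω : ℤ → Ω | ω s ∈ E} :=
  measurableSet_coordSigma_of_dependsOn (I := {s}) (by simpa using hs)
    fun ω ω' h hω => by
      have := h s (by simp)
      simp only [Set.mem_ofPred_eq] at *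
      rwa [← this]

theorem measurableSet_blockOut (hn : 0 < n) (s : ℤ)
    (E : Set ((Fin n → Fin N) × (Fin n → Fin N))) {S : Set ℤ}
    (hS : Set.Ico s (s + n) ⊆ S) :
    MeasurableSet[coordSigma Ω S]
      {ω : ℤ → Ω | (blockAt n (c.input ω) s, c.blockOut ω s) ∈ E} :=
  measurableSet_coordSigma_of_dependsOn (I := Finset.Ico s (s + n)) (by simpa using hS)
    fun ω ω' h hω => by
      have h1 : blockAt n (c.input ω) s = blockAt n (c.input ω') s := by
        funext i
        exact congrArg c.letter (h _ (by simp))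
      have h2 := h s (by simpa using hn)
      simp only [Set.mem_ofPred_eq, blockOut] at *
      rwa [← h1, ← h2]

/-- The one-site marginal law and the block law agree with the target law `Q`. -/
structure Outputs (c : BlockCode N n Ω) (m : Measure Ω) [IsProbabilityMeasure m]
    (Q : Measure (Fin N)) : Prop where
  scan : ∀ t : Set (Fin N), m {w | c.scan w ∈ t} = Q t
  block : ∀ (s : ℤ) (t : Fin n → Set (Fin N)),
    iidMeasure m {ω | ∀ i, c.blockOut ω s i ∈ t i} = ∏ i, Q (t i)

theorem iidMeasure_site (s : ℤ) (E : Set Ω) : iidMeasure m {ω : ℤ → Ω | ω s ∈ E} = m E := by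
  have := (measurePreserving_eval_infinitePi (fun _ : ℤ => m) s).measure_preimage
    (Set.toFinite E).measurableSet.nullMeasurableSet
  exact this

theorem Outputs.measure_meets (h : Outputs c m Q) (hn : 0 < n) (k : ℕ) :
    ∀ (s : ℤ) (t : ℕ → Set (Fin N)), (∀ i, k ≤ i → t i = Set.univ) →
      MeasurableSet[coordSigma Ω (Set.Ici s)] (c.Meets s t) ∧
      iidMeasure m (c.Meets s t) = ∏ i ∈ Finset.range k, Q (t i) := by
  induction k using Nat.strong_induction_on with
  | _ k ih =>
    intro s t ht
    rcases Nat.eq_zero_or_pos k with rfl | hk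
    · have : c.Meets s t = Set.univ := by
        ext ω
        simp [Meets, ht]
      rw [this]
      exact ⟨MeasurableSet.univ, by simp⟩
    obtain ⟨k, rfl⟩ := Nat.exists_eq_add_of_le' hk
    obtain ⟨hm1, he1⟩ := ih k (by omega) (s + 1) (fun i => t (1 + i))
      fun i hi => ht _ (by omega)
    obtain ⟨hm2, he2⟩ := ih (k - n) (by omega) (s + (1 + n : ℕ)) (fun i => t (1 + n + i))
      fun i hi => ht _ (by omega)
    set A := {ω : ℤ → Ω | c.letter (ω s) = c.marker ∧ c.scan (ω s) ∈ t 0}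
    set A' := {ω : ℤ → Ω | c.letter (ω s) ≠ c.marker ∧ c.scan (ω s) ∈ t 0}
    set B := {ω : ℤ → Ω | ∀ i : Fin n, c.blockOut ω (s + 1) i ∈ t (1 + i)}
    set C := c.Meets (s + (1 + n : ℕ)) fun i => t (1 + n + i)
    set D := c.Meets (s + 1) fun i => t (1 + i)
    have hA : MeasurableSet[coordSigma Ω {s}] A :=
      measurableSet_site s {w | c.letter w = c.marker ∧ c.scan w ∈ t 0} rfl
    have hA' : MeasurableSet[coordSigma Ω {s}] A' :=
      measurableSet_site s {w | c.letter w ≠ c.marker ∧ c.scan w ∈ t 0} rfl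
    have hB : MeasurableSet[coordSigma Ω (Set.Ico (s + 1) (s + (1 + n : ℕ)))] B :=
      measurableSet_blockOut hn (s + 1) {z | ∀ i : Fin n, z.2 i ∈ t (1 + i)}
        (by intro i; simp only [Set.mem_Ico]; push_cast; omega)
    have hBC : MeasurableSet[coordSigma Ω (Set.Ici (s + 1))] (B ∩ C) :=
      MeasurableSet.inter (m := coordSigma Ω (Set.Ici (s + 1)))
        (coordSigma_mono (fun i => by simp only [Set.mem_Ico, Set.mem_Ici]; omega) _ hB)
        (coordSigma_mono (fun i => by simp only [Set.mem_Ici]; push_cast; omega) _ hm2)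
    have hdisj : Disjoint ({s} : Set ℤ) (Set.Ici (s + 1)) := by simp
    have hAs : ∀ E, MeasurableSet[coordSigma Ω ({s} : Set ℤ)] E →
        MeasurableSet[coordSigma Ω (Set.Ici s)] E :=
      fun E => coordSigma_mono (by simp) E
    have hs1 : ∀ E, MeasurableSet[coordSigma Ω (Set.Ici (s + 1))] E →
        MeasurableSet[coordSigma Ω (Set.Ici s)] E :=
      fun E => coordSigma_mono (fun i => by simp only [Set.mem_Ici]; omega) E
    have hsplit : c.Meets s t = A ∩ (B ∩ C) ∪ A' ∩ D := by
      rw [meets_eq, Set.inter_assoc]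
    have hM2 : MeasurableSet[coordSigma Ω (Set.Ici s)] (A' ∩ D) :=
      MeasurableSet.inter (m := coordSigma Ω (Set.Ici s)) (hAs _ hA') (hs1 _ hm1)
    have hM1 : MeasurableSet[coordSigma Ω (Set.Ici s)] (A ∩ (B ∩ C)) :=
      MeasurableSet.inter (m := coordSigma Ω (Set.Ici s)) (hAs _ hA) (hs1 _ hBC)
    refine ⟨hsplit ▸ MeasurableSet.union (m := coordSigma Ω (Set.Ici s)) hM1 hM2, ?_⟩
    have hAA' : Disjoint A A' := by
      rw [Set.disjoint_left]
      rintro ω ⟨h1, _⟩ ⟨h2, _⟩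
      exact h2 h1
    have hprod : (∏ i : Fin n, Q (t (1 + i))) * ∏ i ∈ Finset.range (k - n), Q (t (1 + n + i)) =
        ∏ i ∈ Finset.range k, Q (t (1 + i)) := by
      rw [Fin.prod_univ_eq_prod_range fun i => Q (t (1 + i))]
      simp only [add_assoc 1 n]
      rw [← Finset.prod_range_add fun i => Q (t (1 + i))]
      refine (Finset.prod_subset (fun i => by simp only [Finset.mem_range]; omega)
        fun i _ hi => ?_).symm
      rw [ht _ (by simp only [Finset.mem_range] at hi; omega), measure_univ]
    have hsum : iidMeasure m A + iidMeasure m A' = Q (t 0) := by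
      rw [← measure_union hAA' (coordSigma_le _ _ hA'), ← h.scan]
      rw [← iidMeasure_site (m := m) s]
      congr 1
      ext ω
      simp only [A, A', Set.mem_union, Set.mem_ofPred_eq]
      tauto
    rw [hsplit, measure_union (hAA'.mono Set.inter_subset_left Set.inter_subset_left)
      (coordSigma_le _ _ hM2), iidMeasure_inter m hdisj hA hBC, iidMeasure_inter m hdisj hA' hm1,
      iidMeasure_inter m (by
        rw [Set.disjoint_left]
        intro i
        simp only [Set.mem_Ico, Set.mem_Ici]
        omega) hB hm2, he1, he2, h.block, hprod, ← add_mul, hsum, Finset.prod_range_succ', mul_comm]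
    simp only [add_comm 1]

end Law

end BlockCode

theorem measurable_of_dependsOn {Ω β : Type*} [Finite Ω] [MeasurableSpace Ω]
    [MeasurableSingletonClass Ω] [Countable β] [MeasurableSpace β] (I : Finset ℤ)
    {f : (ℤ → Ω) → β} (h : ∀ ω ω' : ℤ → Ω, (∀ i ∈ I, ω i = ω' i) → f ω = f ω') :
    Measurable f :=
  measurable_to_countable' fun _ => coordSigma_le _ _ <|
    measurableSet_coordSigma_of_dependsOn (I := I) le_rfl fun ω ω' hω hb =>
      (h ω ω' hω).symm.trans hb

namespace BlockCode

variable {N n : ℕ} {Ω : Type*} {c : BlockCode N n Ω}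

theorem blockAt_input_congr {ω ω' : ℤ → Ω} {s : ℤ} (h : ∀ i ∈ Finset.Ico s (s + n), ω i = ω' i) :
    blockAt n (c.input ω) s = blockAt n (c.input ω') s := by
  funext i
  exact congrArg c.letter (h _ (by simp))

theorem blockOut_congr {ω ω' : ℤ → Ω} {s : ℤ} (h : ∀ i ∈ Finset.Icc s (s + n), ω i = ω' i) :
    c.blockOut ω s = c.blockOut ω' s := by
  rw [blockOut, blockOut, h s (by simp), blockAt_input_congr (ω' := ω') fun i hi => h i (by
    simp only [Finset.mem_Ico, Finset.mem_Icc] at *; omega)]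

variable [Finite Ω] [MeasurableSpace Ω]
  [MeasurableSingletonClass Ω] {m : Measure Ω} [IsProbabilityMeasure m]

theorem measurable_input : Measurable c.input :=
  measurable_pi_lambda _ fun t => measurable_of_dependsOn {t} fun _ _ h =>
    congrArg c.letter (h t (by simp))

theorem measurable_out (t : ℤ) (j : ℕ) : Measurable fun ω => c.out ω t j := by
  refine measurable_of_dependsOn (Finset.Icc (t - n) (t + n)) fun ω ω' h => ?_
  unfold out
  split_ifs
  · rw [blockOut_congr fun i hi => h i (by simp only [Finset.mem_Icc] at *; omega)]
  · rw [h t (by simp)]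

theorem measurable_parse_input (t : ℤ) :
    Measurable fun ω : ℤ → Ω => parse c.marker n (c.input ω) t :=
  (measurable_parse c.letter t).mono (coordSigma_le _) le_rfl

theorem measurable_out_comp (t : ℤ) {g : (ℤ → Ω) → ℕ} (hg : Measurable g) :
    Measurable fun ω => c.out ω t (g ω) := by
  refine measurable_to_countable' fun b => ?_
  have : (fun ω => c.out ω t (g ω)) ⁻¹' {b} =
      ⋃ j, g ⁻¹' {j} ∩ (fun ω => c.out ω t j) ⁻¹' {b} := by
    ext ω
    simp
  rw [this]
  exact MeasurableSet.iUnion fun j => (hg (measurableSet_singleton j)).inter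
      (measurable_out t j (measurableSet_singleton b))

theorem measurable_output : Measurable c.output :=
  measurable_pi_lambda _ fun t => measurable_out_comp t (measurable_parse_input t)

theorem ae_isParsable (hm : m {w | c.letter w ≠ c.marker} ≠ 0) :
    ∀ᵐ ω ∂(iidMeasure m), IsParsable c.marker n (c.input ω) := by
  set P := iidMeasure m
  let R : ℤ → Set (ℤ → Ω) := fun r => {ω | IsReset c.marker n (c.input ω) r}
  let D : ℤ → Set (ℤ → Ω) := fun t => ⋃ r ∈ Set.Iic t, R r
  have hRm : ∀ r, MeasurableSet (R r) := fun r => coordSigma_le _ _ <|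
    measurableSet_coordSigma_of_dependsOn (I := Finset.Ico (r - n) r) le_rfl
      fun ω ω' h hω i hi => by
        have := hω i hi
        simpa only [input, Function.comp, h i hi] using this
  have hDm : ∀ t, MeasurableSet (D t) := fun t =>
    MeasurableSet.biUnion (Set.to_countable _) fun r _ => hRm r
  have hRs : ∀ r ω, shift ω ∈ R r ↔ ω ∈ R (r + 1) := by
    intro r ω
    simp only [R, IsReset, Set.mem_ofPred_eq, input_shift, shift, Finset.mem_Ico]
    constructor
    · intro h i hi
      have := h (i - 1) (by omega)
      rwa [sub_add_cancel] at this
    · intro h i hi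
      exact h (i + 1) (by omega)
  have hDs : ∀ t, shift ⁻¹' D t = D (t + 1) := by
    intro t
    ext ω
    simp only [D, Set.mem_preimage, Set.mem_iUnion, Set.mem_Iic, hRs, exists_prop]
    constructor
    · rintro ⟨r, hr, h⟩
      exact ⟨r + 1, by omega, h⟩
    · rintro ⟨r, hr, h⟩
      exact ⟨r - 1, by omega, by rwa [sub_add_cancel]⟩
  have hmono : ∀ t t', t ≤ t' → D t ⊆ D t' := fun t t' h =>
    Set.biUnion_mono (Set.Iic_subset_Iic.2 h) fun _ _ => le_rfl
  have hR0 : P (R 0) ≠ 0 := by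
    have h1 : R 0 = Set.pi (Finset.Ico (0 - n : ℤ) 0) fun _ => {w | c.letter w ≠ c.marker} := by
      ext ω
      simp [R, IsReset, input, -zero_sub, -tsub_le_iff_right, -Int.reduceSub]
    rw [h1, Measure.infinitePi_pi _ fun _ _ => (Set.toFinite _).measurableSet]
    exact Finset.prod_ne_zero_iff.2 fun _ _ => hm
  have hD0 : D 0 =ᵐ[P] Set.univ := by
    refine ((ergodic_shift m).ae_empty_or_univ_of_ae_le_preimage (hDm 0).nullMeasurableSet
      (Eventually.of_forall (hDs 0 ▸ hmono 0 (0 + 1) (by omega))) 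
      ).resolve_left ?_
    intro h
    have h1 : P (D 0) = 0 := ae_eq_empty.1 h
    exact hR0 (measure_mono_null (Set.subset_biUnion_of_mem (u := R) (by simp)) h1)
  have hDt : ∀ k : ℕ, ∀ᵐ ω ∂P, ω ∈ D (-k) := by
    intro k
    induction k with
    | zero =>
      rw [ae_eq_univ] at hD0
      exact hD0
    | succ k ih =>
      rw [ae_iff] at ih ⊢
      have h1 := (measurePreserving_shift m).measure_preimage
        (hDm (-((k + 1 : ℕ) : ℤ))).compl.nullMeasurableSet
      change P _ = 0
      change P (D (-((k + 1 : ℕ) : ℤ)))ᶜ = 0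
      rw [← h1, Set.preimage_compl, hDs]
      rw [show -((k + 1 : ℕ) : ℤ) + 1 = -k by push_cast; ring]
      exact ih
  filter_upwards [ae_all_iff.2 hDt] with ω hω t
  have h1 := hmono (-(t.natAbs : ℕ)) t (by omega) (hω t.natAbs)
  simpa [D, R] using h1

theorem map_input {p : Measure (Fin N)} [IsProbabilityMeasure p] (h : m.map c.letter = p) :
    (iidMeasure m).map c.input = iidMeasure p := by
  subst h
  exact Measure.infinitePi_map_pi (f := fun _ => c.letter) _ fun _ => measurable_of_finite _

theorem Outputs.map_output {Q : Measure (Fin N)} [IsProbabilityMeasure Q] (h : Outputs c m Q)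
    (hn : 0 < n) (hm : m {w | c.letter w ≠ c.marker} ≠ 0) :
    (iidMeasure m).map c.output = iidMeasure Q := by
  set P := iidMeasure m
  refine Measure.eq_infinitePi _ fun S t ht => ?_
  rw [Measure.map_apply measurable_output
    (MeasurableSet.pi S.countable_toSet fun _ _ => (Set.toFinite _).measurableSet)]
  let F : ℕ → Set (ℤ → Ω) := fun T =>
    {ω | ∀ i ∈ S, c.out ω i (run c.marker n (c.input ω) (-T) (i + T).toNat) ∈ t i}
  have hF : ∀ T, MeasurableSet (F T) := by
    intro T
    have : F T = ⋂ i ∈ S,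
        (fun ω => c.out ω i (run c.marker n (c.input ω) (-T) (i + T).toNat)) ⁻¹' t i := by
      ext ω
      simp [F]
    rw [this]
    refine S.measurableSet_biInter fun i _ => measurable_out_comp i ?_
      (Set.toFinite _).measurableSet
    exact (measurable_run c.letter _ _).mono (coordSigma_le _) le_rfl
  have hlim : Tendsto (fun T => P (F T)) atTop (𝓝 (P (c.output ⁻¹' (Set.pi S t)))) := by
    refine tendsto_measure_of_ae_tendsto_indicator_of_isFiniteMeasure atTop
      (measurable_output (MeasurableSet.pi S.countable_toSet
        fun _ _ => (Set.toFinite _).measurableSet)) hF ?_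
    filter_upwards [ae_isParsable hm] with ω hω
    have h1 : ∀ᶠ T : ℕ in atTop, ∀ i ∈ S,
        run c.marker n (c.input ω) (-T) (i + T).toNat = parse c.marker n (c.input ω) i := by
      rw [Filter.eventually_all_finset]
      intro i _
      have h2 : Tendsto (fun T : ℕ => (i + T).toNat) atTop atTop :=
        tendsto_atTop_mono (fun T => by omega) (tendsto_sub_atTop_nat i.natAbs)
      filter_upwards [h2.eventually (hω.eventually_run_eq i), eventually_ge_atTop i.natAbs]
        with T hT hTi
      rwa [show i - ((i + T).toNat : ℤ) = -T by omega] at hT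
    filter_upwards [h1] with T hT
    simp only [F, Set.mem_ofPred_eq, Set.mem_preimage, Set.mem_pi, output, Finset.mem_coe]
    exact forall₂_congr fun i hi => by rw [hT i hi]
  refine tendsto_nhds_unique hlim (tendsto_nhds_of_eventually_eq ?_)
  filter_upwards [eventually_ge_atTop (∑ i ∈ S, i.natAbs)] with T hT
  have hTS : ∀ i ∈ S, i.natAbs ≤ T := fun i hi =>
    (Finset.single_le_sum (f := fun i : ℤ => i.natAbs) (fun _ _ => Nat.zero_le _) hi).trans hT
  let t' : ℕ → Set (Fin N) := fun j => if (j - T : ℤ) ∈ S then t (j - T) else Set.univ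
  have hFM : F T = c.Meets (-T) t' := by
    ext ω
    simp only [F, Meets, Set.mem_ofPred_eq, t']
    constructor
    · intro h1 j
      split_ifs with hj
      · have := h1 _ hj
        rw [show ((j : ℤ) - T + T).toNat = j by omega] at this
        rwa [neg_add_eq_sub]
      · trivial
    · intro h1 i hi
      have h2 := hTS i hi
      have h3 := h1 (i + T).toNat
      rw [show (((i + T).toNat : ℕ) : ℤ) = i + T by omega] at h3
      simpa [hi] using h3
  rw [hFM, (h.measure_meets hn (2 * T + 1) (-T) t' fun j hj => ?_).2]
  · symm
    refine Finset.prod_of_injOn (fun i : ℤ => (i + T).toNat) ?_ ?_ ?_ ?_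
    · intro i hi j hj hij
      have := hTS i hi
      have := hTS j hj
      simp only at hij
      omega
    · intro i hi
      have := hTS i hi
      simp only [Finset.coe_range, Set.mem_Iio]
      omega
    · intro j _ hj
      have : (j - T : ℤ) ∉ S := fun h' => hj ⟨j - T, h', by simp⟩
      simp [t', this]
    · intro i hi
      have := hTS i hi
      have h3 : (((i + T).toNat : ℕ) : ℤ) = i + T := by omega
      simp [t', h3, hi]
  · have : (j - T : ℤ) ∉ S := fun h' => by
      have := hTS _ h'
      omega
    simp [t', this]

end BlockCode

/-- The word of length `d` starting at place `i` of a pair of words of length `n`. -/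
def subword {N d n : ℕ} (h : d ≤ n) (i : Fin (n - d + 1)) (z : (Fin n → Fin N) × (Fin n → Fin N)) :
    Fin d → Fin N × Fin N :=
  fun j => (z.1 ⟨i + j, by omega⟩, z.2 ⟨i + j, by omega⟩)

/-- The word of length `d` starting at place `t` of a pair of sequences. -/
def pairWord {N : ℕ} (d : ℕ) (t : ℤ) (z : (ℤ → Fin N) × (ℤ → Fin N)) : Fin d → Fin N × Fin N :=
  fun j => (z.1 (t + j), z.2 (t + j))

namespace BlockCode

variable {N n : ℕ} {Ω : Type*} {c : BlockCode N n Ω}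

theorem output_eq_blockOut {ω : ℤ → Ω} (hω : IsParsable c.marker n (c.input ω)) {s : ℤ}
    (hs : parse c.marker n (c.input ω) s = n) (i : Fin n) :
    c.output ω (s + i) = c.blockOut ω s i := by
  rw [output, hω.parse_add hs i.2.le, out_block]

theorem output_cases (ω : ℤ → Ω) (t : ℤ) : c.output ω t = c.scan (ω t) ∨
    ∃ i : Fin n, c.output ω t = c.blockOut ω (t - (i : ℕ)) i := by
  unfold output out
  split_ifs with h
  · exact Or.inr ⟨⟨n - parse c.marker n (c.input ω) t, by omega⟩, rfl⟩
  · exact Or.inl rfl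

/-- The law of the `n`-block of the input and the corresponding output, at the start of a block. -/
noncomputable def blockLaw [MeasurableSpace Ω] (c : BlockCode N n Ω) (m : Measure Ω)
    [IsProbabilityMeasure m] (s : ℤ) : Measure ((Fin n → Fin N) × (Fin n → Fin N)) :=
  (iidMeasure m).map fun ω => (blockAt n (c.input ω) s, c.blockOut ω s)

variable [Finite Ω] [MeasurableSpace Ω] [MeasurableSingletonClass Ω] {m : Measure Ω}
  [IsProbabilityMeasure m]

theorem blockLaw_apply (s : ℤ) (E : Set ((Fin n → Fin N) × (Fin n → Fin N))) :
    c.blockLaw m s E =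
      iidMeasure m {ω | (blockAt n (c.input ω) s, c.blockOut ω s) ∈ E} := by
  rw [blockLaw, Measure.map_apply ?_ (Set.toFinite _).measurableSet]
  · rfl
  · refine measurable_of_dependsOn (Finset.Icc s (s + n)) fun ω ω' h => ?_
    rw [blockOut_congr h, blockAt_input_congr fun i hi => h i (by
      simp only [Finset.mem_Ico, Finset.mem_Icc] at *; omega)]

variable (c m) in
/-- The probability that the parser is in state `j`. -/
noncomputable def stateProb (j : ℕ) : ℝ :=
  (iidMeasure m).real {ω | parse c.marker n (c.input ω) 0 = j}

theorem measurableSet_parse (t : ℤ) (j : ℕ) :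
    MeasurableSet {ω : ℤ → Ω | parse c.marker n (c.input ω) t = j} :=
  measurable_parse_input t (measurableSet_singleton j)

theorem real_parse_eq (t : ℤ) (j : ℕ) :
    (iidMeasure m).real {ω | parse c.marker n (c.input ω) t = j} = stateProb c m j := by
  have h : ∀ t, (iidMeasure m).real {ω | parse c.marker n (c.input ω) (t + 1) = j} =
      (iidMeasure m).real {ω | parse c.marker n (c.input ω) t = j} := by
    intro t
    rw [measureReal_def, measureReal_def, ← (measurePreserving_shift m).measure_preimage
      (measurableSet_parse t j).nullMeasurableSet]
    simp only [Set.preimage_ofPred_eq, input_shift, parse_shift]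
  induction t using Int.induction_on with
  | zero => rfl
  | succ i ih => rw [h, ih]
  | pred i ih => rw [← h, sub_add_cancel, ih]

theorem real_parse_inter_block (hn : 0 < n) (s : ℤ) (j : ℕ)
    (E : Set ((Fin n → Fin N) × (Fin n → Fin N))) :
    (iidMeasure m).real {ω | parse c.marker n (c.input ω) s = j ∧
      (blockAt n (c.input ω) s, c.blockOut ω s) ∈ E} =
        stateProb c m j * (c.blockLaw m s).real E := by
  have h1 : MeasurableSet[coordSigma Ω (Set.Iio s)]
      {ω : ℤ → Ω | parse c.marker n (c.input ω) s = j} :=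
    measurable_parse c.letter s (measurableSet_singleton j)
  have h2 := measurableSet_blockOut (c := c) hn s E le_rfl
  have h3 := iidMeasure_inter m (by
    rw [Set.disjoint_left]
    intro i
    simp only [Set.mem_Ico, Set.mem_Iio]
    omega) h1 h2
  rw [← real_parse_eq s, measureReal_def, measureReal_def, measureReal_def, blockLaw_apply,
    ← ENNReal.toReal_mul, ← h3]
  rfl

theorem stateProb_eq (hm : m {w | c.letter w ≠ c.marker} ≠ 0) {j : ℕ} (hj : 0 < j) (hjn : j ≤ n) :
    stateProb c m j = stateProb c m n := by
  obtain ⟨l, rfl⟩ := Nat.exists_eq_add_of_le hjn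
  rw [← real_parse_eq (l : ℤ) j]
  refine measureReal_congr ?_
  filter_upwards [ae_isParsable hm] with ω hω
  refine propext ⟨fun h => ?_, fun h => ?_⟩
  · have := hω.parse_sub hj l rfl h
    rwa [sub_self] at this
  · have := hω.parse_add h (Nat.le_add_left l j)
    rwa [zero_add, Nat.add_sub_cancel] at this

theorem stateProb_block (hn : 0 < n) (hm : m {w | c.letter w ≠ c.marker} ≠ 0) :
    stateProb c m n = stateProb c m 0 * m.real {w | c.letter w = c.marker} := by
  have h1 : MeasurableSet[coordSigma Ω (Set.Iio 0)]
      {ω : ℤ → Ω | parse c.marker n (c.input ω) 0 = 0} :=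
    measurable_parse c.letter 0 (measurableSet_singleton 0)
  have h2 := measurableSet_site 0 {w : Ω | c.letter w = c.marker} (Set.mem_singleton (0 : ℤ))
  have h3 := iidMeasure_inter m (by simp) h1 h2
  rw [iidMeasure_site] at h3
  rw [← real_parse_eq 1 n, stateProb, measureReal_def, measureReal_def, measureReal_def,
    ← ENNReal.toReal_mul, ← h3]
  congr 1
  refine measure_congr ?_
  filter_upwards [ae_isParsable hm] with ω hω
  have h4 := hω.parse_succ 0
  rw [zero_add, step] at h4
  have h5 := hω.parse_le 0
  refine propext ⟨fun h => ?_, fun h => ?_⟩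
  · change parse _ _ _ _ = _ at h
    rw [h] at h4
    split_ifs at h4 with h6 h7
    · exact ⟨h6, h7⟩
    all_goals omega
  · obtain ⟨h6, h7⟩ := h
    change parse _ _ _ _ = _ at h6
    change c.input ω 0 = c.marker at h7
    rwa [if_pos h6, if_pos h7] at h4

theorem stateProb_sum (hm : m {w | c.letter w ≠ c.marker} ≠ 0) :
    stateProb c m 0 + n * stateProb c m n = 1 := by
  have h1 : ∑ j ∈ Finset.range (n + 1), stateProb c m j = 1 := by
    unfold stateProb
    have := sum_measureReal_preimage_singleton (μ := iidMeasure m) (Finset.range (n + 1))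
      (f := fun ω : ℤ → Ω => parse c.marker n (c.input ω) 0)
      fun j _ => measurableSet_parse 0 j
    refine this.trans ?_
    rw [measureReal_def, ENNReal.toReal_eq_one_iff, ← measure_univ (μ := iidMeasure m)]
    refine measure_congr ?_
    filter_upwards [ae_isParsable hm] with ω hω
    refine propext ⟨fun _ => trivial, fun _ => ?_⟩
    change parse c.marker n (c.input ω) 0 ∈ (Finset.range (n + 1) : Set ℕ)
    simpa [Nat.lt_succ_iff] using hω.parse_le 0
  rw [Finset.sum_range_succ', add_comm] at h1
  rw [← h1, Finset.sum_congr rfl fun j hj => stateProb_eq hm (Nat.succ_pos j)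
    (by simpa using hj)]
  simp

theorem le_real_pairWord (hn : 0 < n) (hm : m {w | c.letter w ≠ c.marker} ≠ 0) {d : ℕ}
    (hd : d ≤ n) (t : ℤ) {L : Measure ((Fin n → Fin N) × (Fin n → Fin N))}
    (hL : ∀ s, c.blockLaw m s = L) (w : Fin d → Fin N × Fin N) :
    stateProb c m n * ∑ i, L.real {z | subword hd i z = w} ≤
      (iidMeasure m).real {ω | pairWord d t (c.input ω, c.output ω) = w} := by
  let G : Fin (n - d + 1) → Set (ℤ → Ω) := fun i =>
    {ω | parse c.marker n (c.input ω) (t - (i : ℕ)) = n ∧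
      (blockAt n (c.input ω) (t - (i : ℕ)), c.blockOut ω (t - (i : ℕ))) ∈ {z | subword hd i z = w}}
  have hG : ∀ i, (iidMeasure m).real (G i) =
      stateProb c m n * L.real {z | subword hd i z = w} := fun i => by
    rw [real_parse_inter_block hn, hL]
  have hGm : ∀ i, MeasurableSet (G i) := fun i =>
    (measurableSet_parse _ _).inter
      (coordSigma_le _ _ (measurableSet_blockOut hn _ {z | subword hd i z = w} le_rfl))
  have hG' : (iidMeasure m).real (⋃ i, G i) = ∑ i, (iidMeasure m).real (G i) := by
    rw [measureReal_def, measure_iUnion₀ ?_ fun i => (hGm i).nullMeasurableSet, tsum_fintype,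
      ENNReal.toReal_sum fun _ _ => by finiteness]
    · rfl
    · intro i j hij
      rw [Function.onFun, AEDisjoint, ← ae_eq_empty]
      filter_upwards [ae_isParsable hm] with ω hω
      refine propext ⟨fun h => ?_, fun h => h.elim⟩
      obtain ⟨⟨h1, _⟩, h2, _⟩ := h
      have h3 := hω.parse_add h1 (l := i) (by omega)
      have h4 := hω.parse_add h2 (l := j) (by omega)
      rw [sub_add_cancel] at h3 h4
      exact hij (Fin.ext (by omega))
  rw [Finset.mul_sum, Finset.sum_congr rfl fun i _ => (hG i).symm, ← hG']
  refine ENNReal.toReal_mono (by finiteness) (measure_mono_ae ?_)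
  filter_upwards [ae_isParsable hm] with ω hω h
  obtain ⟨i, h1, h2⟩ := Set.mem_iUnion.1 h
  change pairWord d t _ = w
  change subword hd i _ = w at h2
  rw [← h2]
  funext j
  have h3 := output_eq_blockOut hω h1 ⟨i + j, by omega⟩
  have h4 : t - (i : ℕ) + ((i : ℕ) + (j : ℕ) : ℕ) = t + (j : ℕ) := by push_cast; ring
  simp only [h4] at h3
  simp only [pairWord, subword, h3, blockAt, h4]

theorem ae_output_le (hs : ∀ᵐ w ∂m, c.scan w ≤ c.letter w)
    {L : Measure ((Fin n → Fin N) × (Fin n → Fin N))} (hL : ∀ s, c.blockLaw m s = L)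
    (hLm : ∀ᵐ z ∂L, ∀ i, z.2 i ≤ z.1 i) :
    ∀ᵐ ω ∂(iidMeasure m), c.output ω 0 ≤ c.input ω 0 := by
  have h1 : ∀ᵐ ω ∂(iidMeasure m), c.scan (ω 0) ≤ c.letter (ω 0) :=
    (measurePreserving_eval_infinitePi (fun _ : ℤ => m) 0).quasiMeasurePreserving.ae hs
  have h2 : ∀ i : Fin n, ∀ᵐ ω ∂(iidMeasure m),
      ∀ j, c.blockOut ω (0 - (i : ℕ)) j ≤ blockAt n (c.input ω) (0 - (i : ℕ)) j := by
    intro i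
    rw [← hL (0 - (i : ℕ)), ae_iff, blockLaw_apply] at hLm
    exact hLm
  filter_upwards [h1, ae_all_iff.2 h2] with ω h3 h4
  rcases output_cases (c := c) ω 0 with h | ⟨i, h⟩
  · rwa [h]
  · rw [h]
    simpa [blockAt] using h4 i i

theorem almostFactor_bound (hn : 0 < n) (hm : m {w | c.letter w ≠ c.marker} ≠ 0)
    {L : Measure ((Fin n → Fin N) × (Fin n → Fin N))} (hL : ∀ s, c.blockLaw m s = L)
    (f : (Fin n → Fin N) → (Fin n → Fin N)) (A : Set (Fin N)) :
    ∃ P' : Set (ℤ → Fin N), MeasurableSet P' ∧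
      (iidMeasure m).real (symmDiff (c.input ⁻¹' P') {ω | c.output ω 0 ∈ A}) ≤
        stateProb c m 0 + L.real {z | z.2 ≠ f z.1} := by
  refine ⟨⋃ i : Fin n, {x | parse c.marker n x (0 - (i : ℕ)) = n} ∩
    {x | f (blockAt n x (0 - (i : ℕ))) i ∈ A}, MeasurableSet.iUnion fun i => ?_, ?_⟩
  · refine MeasurableSet.inter ?_ ?_
    · exact coordSigma_le _ _
        (measurable_parse (a := c.marker) (n := n) id (0 - (i : ℕ)) (measurableSet_singleton n))
    · refine (measurable_of_dependsOn (Finset.Ico (0 - (i : ℕ)) (0 - (i : ℕ) + n))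
        (f := fun x : ℤ → Fin N => f (blockAt n x (0 - (i : ℕ))) i) fun x x' h => ?_)
          (Set.toFinite A).measurableSet
      have : blockAt n x (0 - (i : ℕ)) = blockAt n x' (0 - (i : ℕ)) := by
        funext j
        exact h _ (by simp)
      rw [this]
  set P := iidMeasure m
  let B : Fin n → Set (ℤ → Ω) := fun i => {ω | parse c.marker n (c.input ω) (0 - (i : ℕ)) = n ∧
    (blockAt n (c.input ω) (0 - (i : ℕ)), c.blockOut ω (0 - (i : ℕ))) ∈ {z | z.2 ≠ f z.1}}
  have hB : ∀ i, P.real (B i) = stateProb c m n * L.real {z | z.2 ≠ f z.1} := fun i => by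
    rw [real_parse_inter_block hn, hL]
  have h0 : (0 : ℝ) ≤ stateProb c m 0 := measureReal_nonneg
  have h1 : P.real (⋃ i, B i) ≤ L.real {z | z.2 ≠ f z.1} := by
    refine (measureReal_iUnion_fintype_le _).trans ?_
    rw [Finset.sum_congr rfl fun i _ => hB i, Finset.sum_const, Finset.card_univ, Fintype.card_fin,
      nsmul_eq_mul, ← mul_assoc]
    exact mul_le_of_le_one_left measureReal_nonneg (by linarith [stateProb_sum (c := c) hm])
  refine le_trans ?_ (add_le_add_right h1 _)
  refine le_trans ?_ (measureReal_union_le _ _)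
  refine ENNReal.toReal_mono (by finiteness) (measure_mono_ae ?_)
  filter_upwards [ae_isParsable hm] with ω hω h
  by_contra hcon
  change ¬ (_ ∨ _) at hcon
  rw [not_or] at hcon
  obtain ⟨h2, h3⟩ := hcon
  change ¬ parse c.marker n (c.input ω) 0 = 0 at h2
  have h4 := hω.parse_le 0
  set j := parse c.marker n (c.input ω) 0 with hj
  have h5 := hω.parse_sub (Nat.pos_of_ne_zero h2) (n - j) (by omega) hj.symm
  let i : Fin n := ⟨n - j, by omega⟩
  have h6 : c.output ω 0 = c.blockOut ω (0 - (i : ℕ)) i := by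
    rw [← output_eq_blockOut hω h5, sub_add_cancel]
  have h7 : c.blockOut ω (0 - (i : ℕ)) = f (blockAt n (c.input ω) (0 - (i : ℕ))) := by
    by_contra h8
    exact h3 (Set.mem_iUnion.2 ⟨i, h5, h8⟩)
  have h9 : ω ∈ c.input ⁻¹' (⋃ i : Fin n, {x | parse c.marker n x (0 - (i : ℕ)) = n} ∩
      {x | f (blockAt n x (0 - (i : ℕ))) i ∈ A}) ↔ ω ∈ {ω | c.output ω 0 ∈ A} := by
    simp only [Set.mem_preimage, Set.mem_iUnion, Set.mem_inter_iff, Set.mem_ofPred_eq, h6, h7]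
    constructor
    · rintro ⟨i', h10, h11⟩
      have h12 := hω.parse_add h10 i'.2.le
      rw [sub_add_cancel, ← hj] at h12
      have : i' = i := Fin.ext (by simp only [i]; omega)
      rwa [this] at h11
    · exact fun h10 => ⟨i, h5, h10⟩
  rcases h with ⟨h10, h11⟩ | ⟨h10, h11⟩
  · exact h11 (h9.1 h10)
  · exact h11 (h9.2 h10)

end BlockCode

section FiniteLaw

variable {A B : Type*} [Fintype A] [MeasurableSpace A] [MeasurableSingletonClass A]
  [Fintype B] [MeasurableSpace B] [MeasurableSingletonClass B]

theorem eq_finLaw {P : Measure A} {w : A → ℝ} (h : ∀ a, P {a} = ENNReal.ofReal (w a)) :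
    P = finLaw w :=
  Measure.ext_of_singleton fun a => by rw [h, finLaw_singleton]

theorem map_snd_finLaw {l : A × B → ℝ} (hl : ∀ s, 0 ≤ l s) :
    (finLaw l).map Prod.snd = finLaw fun b => ∑ a, l (a, b) := by
  classical
  refine eq_finLaw fun b => ?_
  rw [Measure.map_apply measurable_snd (measurableSet_singleton b), measure_eq_sum_singleton,
    ENNReal.ofReal_sum_of_nonneg fun a _ => hl _, Fintype.sum_prod_type]
  simp [finLaw_singleton]

theorem pi_finLaw {n : ℕ} {w : A → ℝ} (hw0 : ∀ a, 0 ≤ w a) (hw1 : ∑ a, w a = 1) :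
    haveI := isProbabilityMeasure_finLaw hw0 hw1
    Measure.pi (fun _ : Fin n => finLaw w) = finLaw fun v : Fin n → A => ∏ i, w (v i) := by
  have := isProbabilityMeasure_finLaw hw0 hw1
  refine eq_finLaw fun v => ?_
  rw [Measure.pi_singleton, ENNReal.ofReal_prod_of_nonneg fun i _ => hw0 _]
  simp only [finLaw_singleton]

end FiniteLaw

theorem map_window_iidMeasure {α : Type*} [MeasurableSpace α] (m : Measure α)
    [IsProbabilityMeasure m] (n : ℕ) (s : ℤ) :
    (iidMeasure m).map (fun ω => blockAt n ω s) = Measure.pi fun _ : Fin n => m := by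
  rw [← Measure.infinitePi_eq_pi]
  exact Measure.map_infinitePi_infinitePi_of_inj (P := fun _ : ℤ => m)
    (f := fun i : Fin n => s + (i : ℤ)) fun i j h => by
      simp only [add_right_inj, Nat.cast_inj] at h
      exact Fin.ext h

/-- The one-site space of the block code constructed from couplings. -/
abbrev CodeSite (N n : ℕ) : Type :=
  Fin N × (Fin N → Fin N) × ((Fin n → Fin N) → (Fin n → Fin N))

theorem measurable_blockAt {α : Type*} [MeasurableSpace α] (n : ℕ) (s : ℤ) :
    Measurable fun ω : ℤ → α => blockAt n ω s :=
  measurable_pi_lambda _ fun _ => measurable_pi_apply _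

/-- Couplings of one-site laws and of `n`-block laws are realised by a block code. -/
theorem exists_blockCode {N n : ℕ} (hn : 0 < n) (a : Fin N) {p q : Fin N → ℝ}
    (hp0 : ∀ i, 0 ≤ p i) (hp1 : ∑ i, p i = 1) (hq0 : ∀ i, 0 ≤ q i) (hq1 : ∑ i, q i = 1)
    {r : Fin N × Fin N → ℝ} (hr : ∀ s, 0 ≤ r s) (hr1 : ∀ x, ∑ y, r (x, y) = p x)
    (hr2 : ∀ y, ∑ x, r (x, y) = q y)
    {l : (Fin n → Fin N) × (Fin n → Fin N) → ℝ} (hl : ∀ s, 0 ≤ l s)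
    (hl1 : ∀ u, ∑ v, l (u, v) = ∏ i, p (u i)) (hl2 : ∀ v, ∑ u, l (u, v) = ∏ i, q (v i)) :
    ∃ (Ω : Type) (_ : Finite Ω) (_ : MeasurableSpace Ω) (_ : MeasurableSingletonClass Ω)
      (m : Measure Ω) (_ : IsProbabilityMeasure m) (c : BlockCode N n Ω),
      c.marker = a ∧ m.map c.letter = finLaw p ∧
      m.map (fun w => (c.letter w, c.scan w)) = finLaw r ∧
      (∀ s, c.blockLaw m s = finLaw l) ∧ c.Outputs m (finLaw q) := by
  have := isProbabilityMeasure_finLaw hp0 hp1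
  have := isProbabilityMeasure_finLaw hq0 hq1
  have : Nonempty (Fin N) := ⟨a⟩
  obtain ⟨κ₁, _, hκ₁⟩ := exists_random_map (fun x y => r (x, y)) fun x y => hr (x, y)
  obtain ⟨κ₂, _, hκ₂⟩ := exists_random_map (fun u v => l (u, v)) fun u v => hl (u, v)
  let m : Measure (CodeSite N n) := (finLaw p).prod (κ₁.prod κ₂)
  let c : BlockCode N n (CodeSite N n) := ⟨a, fun w => w.1, fun w => w.2.1 w.1, fun w => w.2.2⟩
  have hm : ∀ x E F, m ({x} ×ˢ E ×ˢ F) = ENNReal.ofReal (p x) * (κ₁ E * κ₂ F) := fun x E F => by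
    simp only [m, Measure.prod_prod, finLaw_singleton]
  have hpair : m.map (fun w => (c.letter w, c.scan w)) = finLaw r := by
    refine eq_finLaw fun s => ?_
    rw [Measure.map_apply (measurable_of_finite _) (measurableSet_singleton s)]
    have : (fun w : CodeSite N n => (c.letter w, c.scan w)) ⁻¹' {s} =
        {s.1} ×ˢ {φ | φ s.1 = s.2} ×ˢ Set.univ := by
      ext w
      simp only [c, Set.mem_preimage, Set.mem_singleton_iff, Set.mem_prod, Set.mem_ofPred_eq,
        Set.mem_univ, and_true, Prod.ext_iff]
      exact and_congr_right fun h => by rw [h]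
    rw [this, hm, measure_univ, mul_one, ← hr1, hκ₁]
  have hlaw : ∀ s, c.blockLaw m s = finLaw l := by
    intro s
    refine eq_finLaw fun z => ?_
    let t : Fin n → Set (CodeSite N n) := fun i =>
      {z.1 i} ×ˢ Set.univ ×ˢ {ψ | i = ⟨0, hn⟩ → ψ z.1 = z.2}
    have h1 : {ω | (blockAt n (c.input ω) s, c.blockOut ω s) ∈ ({z} : Set _)} =
        (fun ω : ℤ → CodeSite N n => blockAt n ω s) ⁻¹' Set.univ.pi t := by
      ext ω
      simp only [Set.mem_singleton_iff, Set.mem_ofPred_eq, Prod.ext_iff, Set.mem_preimage,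
        Set.mem_pi, Set.mem_univ, true_imp_iff, t, Set.mem_prod, true_and]
      constructor
      · rintro ⟨h2, h3⟩ i
        refine ⟨congrFun h2 i, ?_⟩
        rintro rfl
        rw [BlockCode.blockOut, h2] at h3
        simpa [blockAt, c] using h3
      · intro h
        have h2 : blockAt n (c.input ω) s = z.1 := funext fun i => (h i).1
        refine ⟨h2, ?_⟩
        rw [BlockCode.blockOut, h2]
        simpa [blockAt, c] using (h ⟨0, hn⟩).2 rfl
    have h2 : ∀ i, m (t i) = ENNReal.ofReal (p (z.1 i)) *
        if i = ⟨0, hn⟩ then κ₂ {ψ | ψ z.1 = z.2} else 1 := by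
      intro i
      rw [hm, measure_univ, one_mul]
      split_ifs with h <;> simp [h]
    rw [BlockCode.blockLaw_apply, h1, ← Measure.map_apply
      (measurable_blockAt n s) (Set.toFinite _).measurableSet,
      map_window_iidMeasure, Measure.pi_pi, Finset.prod_congr rfl fun i _ => h2 i,
      Finset.prod_mul_distrib, ← ENNReal.ofReal_prod_of_nonneg fun i _ => hp0 _, ← hl1,
      Finset.prod_ite_eq', if_pos (Finset.mem_univ _), hκ₂]
  refine ⟨CodeSite N n, inferInstance, inferInstance, inferInstance, m, inferInstance, c, rfl, ?_,
    hpair, hlaw, ?_, ?_⟩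
  · exact measurePreserving_fst.map_eq
  · intro t
    have h1 : (m.map fun w => (c.letter w, c.scan w)).map Prod.snd = finLaw q := by
      rw [hpair, map_snd_finLaw hr]
      simp only [hr2]
    rw [← h1, Measure.map_map measurable_snd (measurable_of_finite _),
      Measure.map_apply (measurable_of_finite _) (Set.toFinite _).measurableSet]
    rfl
  · intro s t
    have h1 : (c.blockLaw m s).map Prod.snd = Measure.pi fun _ : Fin n => finLaw q := by
      rw [hlaw, map_snd_finLaw hl, pi_finLaw hq0 hq1]
      simp only [hl2]
    rw [← Measure.pi_pi, ← h1, Measure.map_apply measurable_snd (Set.toFinite _).measurableSet,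
      BlockCode.blockLaw_apply]
    simp [Set.mem_pi]

theorem sum_ite_real_preimage {Z A : Type*} [MeasurableSpace Z] [Fintype A] [MeasurableSpace A]
    [MeasurableSingletonClass A] (P : Measure Z) [IsFiniteMeasure P] {g : Z → A}
    (hg : Measurable g) (E : A → Prop) [DecidablePred E] :
    ∑ s, (if E s then P.real (g ⁻¹' {s}) else 0) = P.real {z | E (g z)} := by
  classical
  rw [← Finset.sum_filter, sum_measureReal_preimage_singleton _
    fun s _ => hg (measurableSet_singleton s)]
  congr 1
  ext z
  simp

theorem finLaw_real {A : Type*} [Fintype A] [MeasurableSpace A] [MeasurableSingletonClass A]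
    {w : A → ℝ} (hw : ∀ a, 0 ≤ w a) (E : A → Prop) [DecidablePred E] :
    (finLaw w).real {a | E a} = ∑ a, if E a then w a else 0 := by
  classical
  have h := measure_eq_sum_singleton (finLaw w) {a | E a}
  simp only [finLaw_singleton, Set.mem_ofPred_eq] at h
  rw [measureReal_def, h, ENNReal.toReal_sum fun a _ => by split_ifs <;> finiteness]
  refine Finset.sum_congr rfl fun a _ => ?_
  split_ifs
  · exact ENNReal.toReal_ofReal (hw a)
  · rfl

theorem shannonH_nonneg {N : ℕ} {p : Fin N → ℝ} (hp0 : ∀ i, 0 ≤ p i) (hp1 : ∑ i, p i = 1) :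
    0 ≤ shannonH p := by
  rw [shannonH, ← Finset.sum_neg_distrib]
  refine Finset.sum_nonneg fun i _ => ?_
  have h1 : p i ≤ 1 := hp1 ▸ Finset.single_le_sum (fun i _ => hp0 i) (Finset.mem_univ i)
  exact neg_nonneg.2 (mul_nonpos_of_nonneg_of_nonpos (hp0 i) (Real.log_nonpos (hp0 i) h1))

/-- A shift invariant monotone joining of the Bernoulli measures with one-site laws `p`, `q`. -/
structure IsJoining {N : ℕ} (p q : Fin N → ℝ) (ζ : Measure ((ℤ → Fin N) × (ℤ → Fin N))) :
    Prop where
  prob : IsProbabilityMeasure ζ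
  fst (s : ℤ) (n : ℕ) (u : Fin n → Fin N) : ζ.real {z | blockAt n z.1 s = u} = ∏ i, p (u i)
  snd (s : ℤ) (n : ℕ) (v : Fin n → Fin N) : ζ.real {z | blockAt n z.2 s = v} = ∏ i, q (v i)
  pair (d : ℕ) (t : ℤ) (w : Fin d → Fin N × Fin N) :
    ζ.real {z | pairWord d t z = w} = ζ.real {z | pairWord d 0 z = w}
  le : ∀ᵐ z ∂ζ, ∀ i : ℤ, z.2 i ≤ z.1 i
  fst_atypical {η : ℝ} (hη : 0 < η) : Tendsto (fun n : ℕ => ζ.real {z | ¬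
    ∏ i, p (blockAt n z.1 0 i) ≤ Real.exp (-(n * (shannonH p - η)))}) atTop (𝓝 0)
  snd_atypical {η : ℝ} (hη : 0 < η) : Tendsto (fun n : ℕ => ζ.real {z | ¬
    Real.exp (-(n * (shannonH q + η))) ≤ ∏ i, q (blockAt n z.2 0 i)}) atTop (𝓝 0)

theorem measurable_blocks {N : ℕ} (n : ℕ) : Measurable
    fun z : (ℤ → Fin N) × (ℤ → Fin N) => (blockAt n z.1 0, blockAt n z.2 0) :=
  ((measurable_blockAt n 0).comp measurable_fst).prodMk
    ((measurable_blockAt n 0).comp measurable_snd)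

theorem tendsto_exp_neg_mul {b : ℝ} (hb : 0 < b) :
    Tendsto (fun n : ℕ => Real.exp (-(n * b))) atTop (𝓝 0) :=
  Real.tendsto_exp_neg_atTop_nhds_zero.comp
    (tendsto_natCast_atTop_atTop.atTop_mul_const hb)

/-- Long blocks of a joining admit a coupling with the same subword statistics in which the second
block is, up to probability `δ`, a function of the first. -/
theorem IsJoining.exists_block_coupling {N : ℕ} {p q : Fin N → ℝ}
    (hq0 : ∀ i, 0 ≤ q i) (hq1 : ∑ i, q i = 1)
    (hH : shannonH q < shannonH p) {ζ : Measure ((ℤ → Fin N) × (ℤ → Fin N))}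
    (hζ : IsJoining p q ζ) [Nonempty (Fin N)] (d : ℕ) {δ : ℝ} (hδ : 0 < δ) :
    ∀ᶠ n : ℕ in atTop, ∃ hd : d ≤ n, ∃ l : (Fin n → Fin N) × (Fin n → Fin N) → ℝ,
      (∀ s, 0 ≤ l s) ∧ (∀ s, l s ≠ 0 → ∀ i, s.2 i ≤ s.1 i) ∧
      (∀ u, ∑ v, l (u, v) = ∏ i, p (u i)) ∧ (∀ v, ∑ u, l (u, v) = ∏ i, q (v i)) ∧
      (∀ w, ∑ i, (finLaw l).real {s | subword hd i s = w} =
        ((n - d + 1 : ℕ) : ℝ) * ζ.real {z | pairWord d 0 z = w}) ∧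
      ∃ f : (Fin n → Fin N) → (Fin n → Fin N), (finLaw l).real {s | s.2 ≠ f s.1} < δ := by
  classical
  have := hζ.prob
  set η := (shannonH p - shannonH q) / 4 with hη_def
  have hη : 0 < η := by rw [hη_def]; linarith
  have hq := shannonH_nonneg hq0 hq1
  let K := Fin d → Fin N × Fin N
  have hsmall : Tendsto (fun n : ℕ => (ζ.real {z | ¬
      ∏ i, p (blockAt n z.1 0 i) ≤ Real.exp (-(n * (shannonH p - η)))} + ζ.real {z | ¬
      Real.exp (-(n * (shannonH q + η))) ≤ ∏ i, q (blockAt n z.2 0 i)}) +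
      (Real.exp (-(n * (2 * η))) + Fintype.card K * Real.exp (-(n * (shannonH p - η)))))
      atTop (𝓝 0) := by
    have h1 := ((hζ.fst_atypical hη).add (hζ.snd_atypical hη)).add
      ((tendsto_exp_neg_mul (show 0 < 2 * η by linarith)).add
        ((tendsto_exp_neg_mul (show 0 < shannonH p - η by linarith)).const_mul
          (Fintype.card K : ℝ)))
    simpa using h1
  filter_upwards [hsmall.eventually_lt_const hδ, eventually_ge_atTop d] with n hn hd
  refine ⟨hd, ?_⟩
  let g := fun z : (ℤ → Fin N) × (ℤ → Fin N) => (blockAt n z.1 0, blockAt n z.2 0)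
  have hg : Measurable g := measurable_blocks n
  let l : (Fin n → Fin N) × (Fin n → Fin N) → ℝ := fun s => ζ.real (g ⁻¹' {s})
  have hl : ∀ s, 0 ≤ l s := fun s => measureReal_nonneg
  have hl1 : ∀ u, ∑ v, l (u, v) = ∏ i, p (u i) := by
    intro u
    have := sum_ite_real_preimage ζ hg fun s => s.1 = u
    rw [← hζ.fst 0 n u, ← this, Fintype.sum_prod_type_right]
    simp [l]
  have hl2 : ∀ v, ∑ u, l (u, v) = ∏ i, q (v i) := by
    intro v
    have := sum_ite_real_preimage ζ hg fun s => s.2 = v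
    rw [← hζ.snd 0 n v, ← this, Fintype.sum_prod_type]
    simp [l]
  have hlm : ∀ s, l s ≠ 0 → ∀ i, s.2 i ≤ s.1 i := by
    intro s
    contrapose!
    rintro ⟨i, hi⟩
    refine (measureReal_eq_zero_iff (by finiteness)).2 ?_
    refine measure_eq_zero_iff_ae_notMem.2 ?_
    filter_upwards [hζ.le] with z hz hzs
    rw [Set.mem_preimage, Set.mem_singleton_iff] at hzs
    rw [← hzs] at hi
    exact absurd (hz (0 + (i : ℕ))) (not_le.2 hi)
  set r := Real.exp (-(n * (shannonH p - η)))
  let A : Finset (Fin n → Fin N) := {u | ∏ i, p (u i) ≤ r}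
  let B : Finset (Fin n → Fin N) := {v | Real.exp (-(n * (shannonH q + η))) ≤ ∏ i, q (v i)}
  let cnt : K → (Fin n → Fin N) × (Fin n → Fin N) → ℝ := fun w s =>
    ∑ i, if subword hd i s = w then 1 else 0
  obtain ⟨l', hl'0, hl'z, hl'1, hl'2, hl'c, f, hf⟩ := exists_coupling_almost_deterministic l hl A B
    cnt r (Real.exp_pos _).le fun u hu => by
      rw [hl1]
      simpa [A] using hu
  have hB : (B.card : ℝ) * r ≤ Real.exp (-(n * (2 * η))) := by
    have h1 : (B.card : ℝ) * Real.exp (-(n * (shannonH q + η))) ≤ 1 := by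
      have h2 : ∑ v : Fin n → Fin N, ∏ i, q (v i) = 1 := by
        rw [← Fintype.piFinset_univ, Finset.sum_prod_piFinset, hq1]
        simp
      rw [← h2, ← nsmul_eq_mul]
      refine (Finset.card_nsmul_le_sum B _ _ fun v hv => ?_).trans
        (Finset.sum_le_sum_of_subset_of_nonneg (Finset.subset_univ B)
          fun v _ _ => Finset.prod_nonneg fun i _ => hq0 _)
      simpa [B] using hv
    have h3 : r = Real.exp (-(n * (shannonH q + η))) * Real.exp (-(n * (2 * η))) := by
      have h4 : shannonH p = shannonH q + 4 * η := by
        rw [hη_def]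
        ring
      change Real.exp _ = _
      rw [← Real.exp_add]
      congr 1
      linear_combination -(n : ℝ) * h4
    rw [h3, ← mul_assoc]
    exact mul_le_of_le_one_left (Real.exp_pos _).le h1
  have hAB : ∑ s, (if s.1 ∈ A ∧ s.2 ∈ B then 0 else l s) ≤ ζ.real {z | ¬
      ∏ i, p (blockAt n z.1 0 i) ≤ r} + ζ.real {z | ¬
      Real.exp (-(n * (shannonH q + η))) ≤ ∏ i, q (blockAt n z.2 0 i)} := by
    have h1 := sum_ite_real_preimage ζ hg fun s => ¬ (s.1 ∈ A ∧ s.2 ∈ B)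
    simp only [ite_not] at h1
    refine h1.le.trans ((measureReal_mono ?_ (by finiteness)).trans (measureReal_union_le _ _))
    intro z
    simp only [A, B, g, Set.mem_ofPred_eq, Finset.mem_filter, Finset.mem_univ, true_and,
      Set.mem_union]
    tauto
  refine ⟨l', hl'0, fun s hs => hlm s fun h => hs (hl'z s h), fun u => (hl'1 u).trans (hl1 u),
    fun v => (hl'2 v).trans (hl2 v), fun w => ?_, f, ?_⟩
  · have hcnt : ∀ L : (Fin n → Fin N) × (Fin n → Fin N) → ℝ, ∑ s, cnt w s * L s =
        ∑ i, ∑ s, if subword hd i s = w then L s else 0 := by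
      intro L
      rw [Finset.sum_comm]
      simp only [cnt, Finset.sum_mul, ite_mul, one_mul, zero_mul]
    have h1 : ∀ i, (finLaw l').real {s | subword hd i s = w} =
        ∑ s, if subword hd i s = w then l' s else 0 := fun i =>
      finLaw_real hl'0 fun s => subword hd i s = w
    rw [Finset.sum_congr rfl fun i _ => h1 i, ← hcnt, hl'c, hcnt]
    have h2 : ∀ i, (∑ s, if subword hd i s = w then l s else 0) =
        ζ.real {z | pairWord d 0 z = w} := by
      intro i
      rw [sum_ite_real_preimage ζ hg fun s => subword hd i s = w, ← hζ.pair d (i : ℕ)]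
      congr 1
      ext z
      have : subword hd i (g z) = pairWord d (i : ℕ) z := by
        funext j
        simp [subword, pairWord, g, blockAt]
      simp only [Set.mem_ofPred_eq, this]
    rw [Finset.sum_congr rfl fun i _ => h2 i]
    simp
  · rw [finLaw_real hl'0 fun s => s.2 ≠ f s.1]
    simp only [ne_eq, ite_not]
    refine lt_of_le_of_lt hf (lt_of_le_of_lt ?_ hn)
    rw [add_mul]
    exact add_le_add hAB (add_le_add hB le_rfl)

section Joinings

variable {N : ℕ} {p q : Fin N → ℝ}

theorem iidMeasure_real_blockAt (hp0 : ∀ i, 0 ≤ p i) (hp1 : ∑ i, p i = 1) (s : ℤ) {n : ℕ}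
    (u : Fin n → Fin N) :
    haveI := isProbabilityMeasure_finLaw hp0 hp1
    (iidMeasure (finLaw p)).real {x | blockAt n x s = u} = ∏ i, p (u i) := by
  have := isProbabilityMeasure_finLaw hp0 hp1
  have h := map_window_iidMeasure (finLaw p) n s
  have h2 := congrArg (fun M => M {u}) h
  rw [Measure.map_apply (measurable_blockAt n s) (measurableSet_singleton u), pi_finLaw hp0 hp1,
    finLaw_singleton] at h2
  exact (congrArg ENNReal.toReal h2).trans
    (ENNReal.toReal_ofReal (Finset.prod_nonneg fun i _ => hp0 _))

theorem measureReal_fst {X Y : Type*} [MeasurableSpace X] [MeasurableSpace Y]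
    {ζ : Measure (X × Y)} {μ : Measure X} (h : ζ.map Prod.fst = μ) {E : Set X}
    (hE : MeasurableSet E) : ζ.real {z | z.1 ∈ E} = μ.real E := by
  rw [← h, map_measureReal_apply measurable_fst hE]
  rfl

theorem measureReal_snd {X Y : Type*} [MeasurableSpace X] [MeasurableSpace Y]
    {ζ : Measure (X × Y)} {ν : Measure Y} (h : ζ.map Prod.snd = ν) {E : Set Y}
    (hE : MeasurableSet E) : ζ.real {z | z.2 ∈ E} = ν.real E := by
  rw [← h, map_measureReal_apply measurable_snd hE]
  rfl

theorem measurableSet_blockAt (n : ℕ) (s : ℤ) (E : (Fin n → Fin N) → Prop) :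
    MeasurableSet {x : ℤ → Fin N | E (blockAt n x s)} :=
  measurable_blockAt n s (Set.toFinite {u | E u}).measurableSet

theorem measurable_pairWord (d : ℕ) (t : ℤ) : Measurable (pairWord (N := N) d t) :=
  measurable_pi_lambda _ fun _ => ((measurable_pi_apply _).comp measurable_fst).prodMk
    ((measurable_pi_apply _).comp measurable_snd)

theorem tendsto_real_not_typical (hp0 : ∀ i, 0 ≤ p i) (hp1 : ∑ i, p i = 1) {η : ℝ} (hη : 0 < η) :
    haveI := isProbabilityMeasure_finLaw hp0 hp1
    Tendsto (fun n : ℕ => (iidMeasure (finLaw p)).real {x | ¬ (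
      Real.exp (-(n * (shannonH p + η))) ≤ ∏ i, p (blockAt n x 0 i) ∧
      ∏ i, p (blockAt n x 0 i) ≤ Real.exp (-(n * (shannonH p - η))))}) atTop (𝓝 0) := by
  have := isProbabilityMeasure_finLaw hp0 hp1
  have h := (ENNReal.tendsto_toReal ENNReal.zero_ne_top).comp
    (tendsto_measure_not_typical hp0 hp1 hη)
  refine h.congr fun n => ?_
  simp only [Finset.prod_range, blockAt, zero_add]
  rfl

/-- The left shift on pairs of sequences. -/
def pairShift (z : (ℤ → Fin N) × (ℤ → Fin N)) : (ℤ → Fin N) × (ℤ → Fin N) :=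
  (shiftMap z.1, shiftMap z.2)

theorem real_pairWord_eq {ζ : Measure ((ℤ → Fin N) × (ℤ → Fin N))}
    (hS : MeasurePreserving pairShift ζ ζ) (d : ℕ) (t : ℤ) (w : Fin d → Fin N × Fin N) :
    ζ.real {z | pairWord d t z = w} = ζ.real {z | pairWord d 0 z = w} := by
  have h : ∀ t : ℤ, ζ.real {z | pairWord d (t + 1) z = w} = ζ.real {z | pairWord d t z = w} := by
    intro t
    have hm : MeasurableSet {z | pairWord d t z = w} :=
      measurable_pairWord d t (measurableSet_singleton w)
    rw [measureReal_def, measureReal_def, ← hS.measure_preimage hm.nullMeasurableSet]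
    have : ∀ z : (ℤ → Fin N) × (ℤ → Fin N),
        pairWord d t (pairShift z) = pairWord d (t + 1) z := fun z => by
      funext j
      simp only [pairWord, pairShift, shiftMap, add_right_comm]
    simp only [← this]
    rfl
  induction t using Int.induction_on with
  | zero => rfl
  | succ i ih => rw [h, ih]
  | pred i ih => rw [← h, sub_add_cancel, ih]

theorem ae_le_of_measurePreserving {ζ : Measure ((ℤ → Fin N) × (ℤ → Fin N))}
    [IsProbabilityMeasure ζ] (hS : MeasurePreserving pairShift ζ ζ)
    (h0 : ζ {z | z.2 0 ≤ z.1 0} = 1) : ∀ᵐ z ∂ζ, ∀ i : ℤ, z.2 i ≤ z.1 i := by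
  have hmeas : ∀ i : ℤ, MeasurableSet {z : (ℤ → Fin N) × (ℤ → Fin N) | z.2 i ≤ z.1 i} := fun i =>
    measurableSet_le ((measurable_pi_apply i).comp measurable_snd)
      ((measurable_pi_apply i).comp measurable_fst)
  have h : ∀ i : ℤ, ζ {z | z.2 (i + 1) ≤ z.1 (i + 1)} = ζ {z | z.2 i ≤ z.1 i} := fun i => by
    rw [← hS.measure_preimage (hmeas i).nullMeasurableSet]
    rfl
  rw [ae_all_iff]
  intro i
  refine (mem_ae_iff_prob_eq_one (hmeas i)).2 ?_
  induction i using Int.induction_on with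
  | zero => exact h0
  | succ i ih => rw [h, ih]
  | pred i ih => rw [← h, sub_add_cancel, ih]

theorem isJoining_of_mem {μ ν : Measure (ℤ → Fin N)} (hp0 : ∀ i, 0 ≤ p i) (hp1 : ∑ i, p i = 1)
    (hq0 : ∀ i, 0 ≤ q i) (hq1 : ∑ i, q i = 1) (hμ : IsBernoulli p μ) (hν : IsBernoulli q ν)
    {ζ : ProbabilityMeasure ((ℤ → Fin N) × (ℤ → Fin N))} (hζ : ζ ∈ MonotoneJoinings μ ν) :
    IsJoining p q (ζ : Measure ((ℤ → Fin N) × (ℤ → Fin N))) := by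
  obtain ⟨h1, h2, h3, h4⟩ := hζ
  have := isProbabilityMeasure_finLaw hp0 hp1
  have := isProbabilityMeasure_finLaw hq0 hq1
  obtain rfl := isBernoulli_eq_iidMeasure hp0 hp1 hμ
  obtain rfl := isBernoulli_eq_iidMeasure hq0 hq1 hν
  refine ⟨inferInstance, fun s n u => ?_, fun s n v => ?_,
    real_pairWord_eq h3.toMeasurePreserving,
    ae_le_of_measurePreserving h3.toMeasurePreserving h4, fun {η} hη => ?_, fun {η} hη => ?_⟩
  · exact (measureReal_fst h1 (measurableSet_blockAt n s fun x => x = u)).trans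
      (iidMeasure_real_blockAt hp0 hp1 s u)
  · exact (measureReal_snd h2 (measurableSet_blockAt n s fun x => x = v)).trans
      (iidMeasure_real_blockAt hq0 hq1 s v)
  · refine squeeze_zero (fun _ => measureReal_nonneg) (fun n => ?_)
      (tendsto_real_not_typical hp0 hp1 hη)
    refine (measureReal_fst h1 (measurableSet_blockAt n 0 fun u =>
      ¬ ∏ i, p (u i) ≤ Real.exp (-(n * (shannonH p - η))))).le.trans
        (measureReal_mono (fun x hx hx' => hx hx'.2) (by finiteness))
  · refine squeeze_zero (fun _ => measureReal_nonneg) (fun n => ?_)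
      (tendsto_real_not_typical hq0 hq1 hη)
    refine (measureReal_snd h2 (measurableSet_blockAt n 0 fun u =>
      ¬ Real.exp (-(n * (shannonH q + η))) ≤ ∏ i, q (u i))).le.trans
        (measureReal_mono (fun x hx hx' => hx hx'.1) (by finiteness))

end Joinings

section Approximation

theorem ae_finLaw {A : Type*} [Fintype A] [MeasurableSpace A] [MeasurableSingletonClass A]
    {w : A → ℝ} {E : A → Prop} (h : ∀ a, w a ≠ 0 → E a) : ∀ᵐ a ∂(finLaw w), E a := by
  classical
  rw [ae_iff, measure_eq_sum_singleton]
  refine Finset.sum_eq_zero fun a _ => ?_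
  split_ifs with ha
  · rw [finLaw_singleton, not_imp_comm.1 (h a) ha, ENNReal.ofReal_zero]
  · rfl

variable {N : ℕ} {p q : Fin N → ℝ}

theorem exists_prob_lt_one (hp0 : ∀ i, 0 ≤ p i) (hp1 : ∑ i, p i = 1) (hH : 0 < shannonH p) :
    ∃ a, 0 < p a ∧ p a < 1 := by
  by_contra! h
  refine hH.ne' ?_
  rw [shannonH, neg_eq_zero]
  refine Finset.sum_eq_zero fun i _ => ?_
  rcases (hp0 i).eq_or_lt with h0 | h0
  · rw [← h0, zero_mul]
  · have h1 : p i ≤ 1 := hp1 ▸ Finset.single_le_sum (fun i _ => hp0 i) (Finset.mem_univ i)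
    rw [h1.antisymm (h i h0), Real.log_one, mul_zero]

theorem IsJoining.exists_site_coupling {ζ : Measure ((ℤ → Fin N) × (ℤ → Fin N))}
    (hζ : IsJoining p q ζ) : ∃ r : Fin N × Fin N → ℝ, (∀ s, 0 ≤ r s) ∧
      (∀ s, r s ≠ 0 → s.2 ≤ s.1) ∧ (∀ x, ∑ y, r (x, y) = p x) ∧ ∀ y, ∑ x, r (x, y) = q y := by
  classical
  have := hζ.prob
  let g := fun z : (ℤ → Fin N) × (ℤ → Fin N) => (z.1 0, z.2 0)
  have hg : Measurable g := ((measurable_pi_apply 0).comp measurable_fst).prodMk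
    ((measurable_pi_apply 0).comp measurable_snd)
  have hword : ∀ (x : ℤ → Fin N) (a : Fin N), (blockAt 1 x 0 = fun _ => a) ↔ x 0 = a := by
    intro x a
    simp [funext_iff, blockAt]
  refine ⟨fun s => ζ.real (g ⁻¹' {s}), fun s => measureReal_nonneg, fun s => ?_, fun x => ?_,
    fun y => ?_⟩
  · contrapose!
    intro hs
    refine (measureReal_eq_zero_iff (by finiteness)).2 (measure_eq_zero_iff_ae_notMem.2 ?_)
    filter_upwards [hζ.le] with z hz hzs
    rw [Set.mem_preimage, Set.mem_singleton_iff] at hzs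
    rw [← hzs] at hs
    exact absurd (hz 0) (not_le.2 hs)
  · have h1 := hζ.fst 0 1 fun _ => x
    have h2 := sum_ite_real_preimage ζ hg fun s => s.1 = x
    simp only [hword, Finset.univ_unique, Finset.prod_const, Finset.card_singleton, pow_one] at h1
    rw [← h1, ← h2, Fintype.sum_prod_type_right]
    simp
  · have h1 := hζ.snd 0 1 fun _ => y
    have h2 := sum_ite_real_preimage ζ hg fun s => s.2 = y
    simp only [hword, Finset.univ_unique, Finset.prod_const, Finset.card_singleton, pow_one] at h1
    rw [← h1, ← h2, Fintype.sum_prod_type]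
    simp

/-- The joint law of the input and the output of a block code. -/
noncomputable def BlockCode.joining {n : ℕ} {Ω : Type*} [MeasurableSpace Ω] (c : BlockCode N n Ω)
    (m : Measure Ω) [IsProbabilityMeasure m] : Measure ((ℤ → Fin N) × (ℤ → Fin N)) :=
  (iidMeasure m).map fun ω => (c.input ω, c.output ω)

namespace BlockCode

variable {n : ℕ} {Ω : Type*} {c : BlockCode N n Ω} [Finite Ω] [MeasurableSpace Ω]
  [MeasurableSingletonClass Ω] {m : Measure Ω} [IsProbabilityMeasure m]

theorem measurable_pair : Measurable fun ω => (c.input ω, c.output ω) :=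
  measurable_input.prodMk measurable_output

theorem joining_apply {E : Set ((ℤ → Fin N) × (ℤ → Fin N))} (hE : MeasurableSet E) :
    c.joining m E = iidMeasure m {ω | (c.input ω, c.output ω) ∈ E} :=
  Measure.map_apply measurable_pair hE

theorem isProbabilityMeasure_joining : IsProbabilityMeasure (c.joining m) :=
  Measure.isProbabilityMeasure_map measurable_pair.aemeasurable

theorem measurable_pairShift :
    Measurable fun z : (ℤ → Fin N) × (ℤ → Fin N) => (shiftMap z.1, shiftMap z.2) :=
  (measurable_shift.comp measurable_fst).prodMk (measurable_shift.comp measurable_snd)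

theorem ergodic_joining :
    Ergodic (fun z : (ℤ → Fin N) × (ℤ → Fin N) => (shiftMap z.1, shiftMap z.2)) (c.joining m) := by
  have h : MeasurePreserving (fun ω => (c.input ω, c.output ω)) (iidMeasure m) (c.joining m) :=
    ⟨measurable_pair, rfl⟩
  refine h.ergodic_of_ergodic_semiconj (ergodic_shift m) measurable_pairShift ?_
  intro ω
  change (c.input (shift ω), c.output (shift ω)) = _
  rw [input_shift, output_shift]
  rfl

theorem joining_mem {p q : Measure (Fin N)} [IsProbabilityMeasure p] [IsProbabilityMeasure q]
    (hn : 0 < n) (hm : m {w | c.letter w ≠ c.marker} ≠ 0) (hp : m.map c.letter = p)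
    (hq : c.Outputs m q) (hle : ∀ᵐ ω ∂(iidMeasure m), c.output ω 0 ≤ c.input ω 0) :
    (⟨c.joining m, isProbabilityMeasure_joining⟩ : ProbabilityMeasure _) ∈
      MonotoneJoinings (iidMeasure p) (iidMeasure q) := by
  refine ⟨?_, ?_, ergodic_joining, ?_⟩
  · refine (Measure.map_map measurable_fst measurable_pair).trans (map_input hp)
  · refine (Measure.map_map measurable_snd measurable_pair).trans (hq.map_output hn hm)
  · have h1 : MeasurableSet {z : (ℤ → Fin N) × (ℤ → Fin N) | z.2 0 ≤ z.1 0} :=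
      measurableSet_le ((measurable_pi_apply 0).comp measurable_snd)
        ((measurable_pi_apply 0).comp measurable_fst)
    refine (joining_apply h1).trans ?_
    rw [← measure_univ (μ := iidMeasure m)]
    exact measure_congr (eventuallyEq_univ.2 hle)

theorem isAlmostFactor_joining (hn : 0 < n) (hm : m {w | c.letter w ≠ c.marker} ≠ 0)
    {L : Measure ((Fin n → Fin N) × (Fin n → Fin N))} (hL : ∀ s, c.blockLaw m s = L)
    (f : (Fin n → Fin N) → (Fin n → Fin N)) {ε : ℝ}
    (hε : stateProb c m 0 + L.real {z | z.2 ≠ f z.1} < ε) : IsAlmostFactor (c.joining m) ε := by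
  intro A
  obtain ⟨P', hP', h⟩ := almostFactor_bound hn hm hL f A
  refine ⟨P', hP', ?_⟩
  have hA : MeasurableSet {y : ℤ → Fin N | y 0 ∈ A} :=
    measurable_pi_apply 0 (Set.toFinite A).measurableSet
  rw [joining_apply ((hP'.prod .univ).symmDiff (MeasurableSet.univ.prod hA)),
    ENNReal.lt_ofReal_iff_toReal_lt (by finiteness)]
  refine lt_of_eq_of_lt ?_ (h.trans_lt hε)
  rw [measureReal_def]
  congr 2
  ext ω
  simp [Set.mem_symmDiff]

end BlockCode

/-- A joining is approximated on words of length `d` by ergodic monotone joinings that are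
`ε`-almost factors. -/
theorem IsJoining.exists_almostFactor {ζ : Measure ((ℤ → Fin N) × (ℤ → Fin N))}
    (hζ : IsJoining p q ζ) (hp0 : ∀ i, 0 ≤ p i) (hp1 : ∑ i, p i = 1) (hq0 : ∀ i, 0 ≤ q i)
    (hq1 : ∑ i, q i = 1) (hH : shannonH q < shannonH p) {ε δ : ℝ} (hε : 0 < ε) (hδ : 0 < δ)
    (d : ℕ) (t : ℤ) :
    haveI := isProbabilityMeasure_finLaw hp0 hp1
    haveI := isProbabilityMeasure_finLaw hq0 hq1
    ∃ ζ' ∈ MonotoneJoinings (iidMeasure (finLaw p)) (iidMeasure (finLaw q)),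
      IsAlmostFactor (ζ' : Measure ((ℤ → Fin N) × (ℤ → Fin N))) ε ∧
      ∀ w, (1 - δ) * ζ.real {z | pairWord d t z = w} ≤
        (ζ' : Measure ((ℤ → Fin N) × (ℤ → Fin N))).real {z | pairWord d t z = w} := by
  have := isProbabilityMeasure_finLaw hp0 hp1
  have := isProbabilityMeasure_finLaw hq0 hq1
  obtain ⟨a, ha0, ha1⟩ :=
    exists_prob_lt_one hp0 hp1 ((shannonH_nonneg hq0 hq1).trans_lt hH)
  have : Nonempty (Fin N) := ⟨a⟩
  set γ := min (ε / 2) (δ / (1 + d)) with hγ_def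
  have hγ : 0 < γ := lt_min (by positivity) (by positivity)
  have hlim : Tendsto (fun n : ℕ => (n : ℝ) * (p a * γ)) atTop atTop :=
    tendsto_natCast_atTop_atTop.atTop_mul_const (by positivity)
  obtain ⟨n, ⟨hd, l, hl0, hlm, hl1, hl2, hlc, f, hf⟩, hnγ, hn⟩ :=
    ((hζ.exists_block_coupling hq0 hq1 hH d (half_pos hε)).and
      ((hlim.eventually_gt_atTop 1).and (eventually_gt_atTop 0))).exists
  obtain ⟨r, hr0, hrm, hr1, hr2⟩ := hζ.exists_site_coupling
  obtain ⟨Ω, _, _, _, m, _, c, hca, hcp, hcr, hcl, hcq⟩ :=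
    exists_blockCode hn a hp0 hp1 hq0 hq1 hr0 hr1 hr2 hl0 hl1 hl2
  have hma : m.real {w | c.letter w = c.marker} = p a := by
    have h1 : (m.map c.letter).real {a} = p a := by
      rw [hcp, measureReal_def, finLaw_singleton, ENNReal.toReal_ofReal (hp0 a)]
    rw [map_measureReal_apply (measurable_of_finite _) (measurableSet_singleton a)] at h1
    rw [hca]
    exact h1
  have hm : m {w | c.letter w ≠ c.marker} ≠ 0 := by
    intro h0
    have h1 : m {w | c.letter w = c.marker} = 1 :=
      (prob_compl_eq_zero_iff (Set.toFinite {w | c.letter w = c.marker}).measurableSet).1 h0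
    rw [measureReal_def, h1, ENNReal.toReal_one] at hma
    exact ha1.ne' hma
  have hsum := BlockCode.stateProb_sum hm
  rw [BlockCode.stateProb_block hn hm, hma] at hsum
  set u := BlockCode.stateProb c m 0 with hu_def
  have hu0 : 0 ≤ u := measureReal_nonneg
  have huγ : u < γ := by
    by_contra! h
    nlinarith [mul_le_mul_of_nonneg_right h (show 0 ≤ 1 + n * p a by positivity)]
  have hs : ∀ᵐ w ∂m, c.scan w ≤ c.letter w := by
    have h1 := ae_finLaw hrm
    rw [← hcr] at h1
    exact ae_of_ae_map (measurable_of_finite _).aemeasurable h1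
  refine ⟨_, BlockCode.joining_mem hn hm hcp hcq
    (BlockCode.ae_output_le hs hcl (ae_finLaw hlm)),
    BlockCode.isAlmostFactor_joining hn hm hcl f ?_, fun w => ?_⟩
  · have := min_le_left (ε / 2) (δ / (1 + d))
    linarith
  · have h1 := BlockCode.le_real_pairWord hn hm hd t hcl w
    have h2 : MeasurableSet {z | pairWord d t z = w} :=
      measurable_pairWord d t (measurableSet_singleton w)
    have h3 : (c.joining m).real {z | pairWord d t z = w} =
        (iidMeasure m).real {ω | pairWord d t (c.input ω, c.output ω) = w} :=
      congrArg ENNReal.toReal (BlockCode.joining_apply h2)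
    refine le_trans ?_ (h1.trans_eq h3.symm)
    rw [hlc, hζ.pair, ← mul_assoc, BlockCode.stateProb_block hn hm, hma]
    refine mul_le_mul_of_nonneg_right ?_ measureReal_nonneg
    have h4 : u * (1 + d) ≤ δ := by
      have h5 : u ≤ δ / (1 + d) := huγ.le.trans (min_le_right _ _)
      rwa [le_div_iff₀ (by positivity)] at h5
    rw [Nat.cast_add, Nat.cast_sub hd, Nat.cast_one]
    have h6 : u * p a * d ≤ u * d := by
      have : u * d * p a ≤ u * d * 1 := mul_le_mul_of_nonneg_left ha1.le (by positivity)
      linarith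
    have h7 : 0 ≤ u * p a := by positivity
    linarith

end Approximation

section WeakConvergence

variable {N : ℕ}

theorem pairWord_eq_iff {k : ℕ} {z z' : (ℤ → Fin N) × (ℤ → Fin N)} :
    pairWord (2 * k) (-k) z' = pairWord (2 * k) (-k) z ↔
      ∀ i : ℤ, -k ≤ i → i < k → z'.1 i = z.1 i ∧ z'.2 i = z.2 i := by
  refine ⟨fun h i hi hik => ?_, fun h => funext fun j => ?_⟩
  · have h1 := congrFun h ⟨(i + k).toNat, by omega⟩
    have h2 : -(k : ℤ) + ((i + k).toNat : ℕ) = i := by omega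
    simpa only [pairWord, h2, Prod.mk.injEq] using h1
  · have h1 := h (-k + (j : ℕ)) (by omega) (by omega)
    exact Prod.ext h1.1 h1.2

/-- The set of pairs of sequences whose window of radius `k` determines membership in `U`. -/
def windowInterior (U : Set ((ℤ → Fin N) × (ℤ → Fin N))) (k : ℕ) :
    Set ((ℤ → Fin N) × (ℤ → Fin N)) :=
  {z | ∀ z', pairWord (2 * k) (-k) z' = pairWord (2 * k) (-k) z → z' ∈ U}

variable {U : Set ((ℤ → Fin N) × (ℤ → Fin N))}

theorem windowInterior_subset (k : ℕ) : windowInterior U k ⊆ U := fun z hz => hz z rfl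

theorem monotone_windowInterior : Monotone (windowInterior U) := by
  intro k l hkl z hz z' hz'
  rw [pairWord_eq_iff] at hz'
  exact hz z' (pairWord_eq_iff.2 fun i hi hik => hz' i (by omega) (by omega))

theorem exists_window_subset {V : Set (ℤ → Fin N)} (hV : IsOpen V) {x : ℤ → Fin N} (hx : x ∈ V) :
    ∃ k : ℕ, ∀ x', (∀ i : ℤ, -k ≤ i → i < k → x' i = x i) → x' ∈ V := by
  obtain ⟨I, u, hu, hIV⟩ := isOpen_pi_iff.1 hV x hx
  refine ⟨I.sup Int.natAbs + 1, fun x' hx' => hIV fun i hi => ?_⟩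
  have h1 : i.natAbs ≤ I.sup Int.natAbs := Finset.le_sup (f := Int.natAbs) hi
  rw [hx' i (by omega) (by omega)]
  exact (hu i hi).2

theorem iUnion_windowInterior (hU : IsOpen U) : ⋃ k, windowInterior U k = U := by
  refine Set.Subset.antisymm (Set.iUnion_subset windowInterior_subset) fun z hz => ?_
  obtain ⟨V, W, hV, hW, hzV, hzW, hVW⟩ := isOpen_prod_iff.1 hU z.1 z.2 hz
  obtain ⟨k, hk⟩ := exists_window_subset hV hzV
  obtain ⟨l, hl⟩ := exists_window_subset hW hzW
  refine Set.mem_iUnion.2 ⟨max k l, fun z' hz' => ?_⟩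
  rw [pairWord_eq_iff] at hz'
  exact hVW ⟨hk _ fun i hi hik => (hz' i (by omega) (by omega)).1,
    hl _ fun i hi hik => (hz' i (by omega) (by omega)).2⟩

theorem real_windowInterior (ζ : Measure ((ℤ → Fin N) × (ℤ → Fin N))) [IsFiniteMeasure ζ] (k : ℕ)
    (E : Finset (Fin (2 * k) → Fin N × Fin N))
    (hE : ∀ z, pairWord (2 * k) (-k) z ∈ E ↔ z ∈ windowInterior U k) :
    ζ.real (windowInterior U k) = ∑ w ∈ E, ζ.real {z | pairWord (2 * k) (-k) z = w} := by
  have h := sum_measureReal_preimage_singleton (μ := ζ) E fun w _ =>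
    measurable_pairWord (2 * k) (-k) (measurableSet_singleton w)
  have h2 : pairWord (2 * k) (-k) ⁻¹' (E : Set (Fin (2 * k) → Fin N × Fin N)) =
      windowInterior U k := Set.ext hE
  rw [h2] at h
  exact h.symm

/-- Probability measures that asymptotically dominate `ζ` on cylinders converge weakly to `ζ`. -/
theorem tendsto_of_le_pairWord {ζ : ProbabilityMeasure ((ℤ → Fin N) × (ℤ → Fin N))}
    {ζs : ℕ → ProbabilityMeasure ((ℤ → Fin N) × (ℤ → Fin N))}
    (h : ∀ (k : ℕ) w, (1 - 1 / ((k : ℝ) + 1)) *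
        (ζ : Measure ((ℤ → Fin N) × (ℤ → Fin N))).real {z | pairWord (2 * k) (-k) z = w} ≤
      (ζs k : Measure ((ℤ → Fin N) × (ℤ → Fin N))).real {z | pairWord (2 * k) (-k) z = w}) :
    Tendsto ζs atTop (𝓝 ζ) := by
  classical
  refine tendsto_of_forall_isOpen_le_liminf' fun U hU => ?_
  set Z := (ζ : Measure ((ℤ → Fin N) × (ℤ → Fin N))) with hZ
  have h1 : Tendsto (fun k => Z.real (windowInterior U k)) atTop (𝓝 (Z.real U)) := by
    have := tendsto_measure_iUnion_atTop (μ := Z) (monotone_windowInterior (U := U))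
    rw [iUnion_windowInterior hU] at this
    exact (ENNReal.tendsto_toReal (by finiteness)).comp this
  have h2 : Tendsto (fun k : ℕ => ENNReal.ofReal ((1 - 1 / ((k : ℝ) + 1)) *
      Z.real (windowInterior U k))) atTop (𝓝 (Z U)) := by
    have h3 := ENNReal.tendsto_ofReal
      (((tendsto_one_div_add_atTop_nhds_zero_nat (𝕜 := ℝ)).const_sub 1).mul h1)
    rwa [sub_zero, one_mul, ofReal_measureReal (by finiteness)] at h3
  rw [← h2.liminf_eq]
  refine liminf_le_liminf (Eventually.of_forall fun k => ?_)
  let E : Finset (Fin (2 * k) → Fin N × Fin N) :=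
    {w | ∀ z', pairWord (2 * k) (-k) z' = w → z' ∈ U}
  have hE : ∀ z, pairWord (2 * k) (-k) z ∈ E ↔ z ∈ windowInterior U k := fun z => by
    simp [E, windowInterior]
  refine ENNReal.ofReal_le_of_le_toReal (le_trans ?_
    (measureReal_mono (windowInterior_subset k) (by finiteness)))
  rw [real_windowInterior _ k E hE, real_windowInterior _ k E hE, Finset.mul_sum]
  exact Finset.sum_le_sum fun w _ => h k w

end WeakConvergence

end MonotoneSinai

/-- The `ε`-almost factors form a dense subset of the space of ergodic monotone
joinings. -/
theorem almost_factors_dense {N : ℕ} (p q : Fin N → ℝ)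
    (hp0 : ∀ i, 0 ≤ p i) (hp1 : ∑ i, p i = 1)
    (hq0 : ∀ i, 0 ≤ q i) (hq1 : ∑ i, q i = 1)
    (hH : shannonH p > shannonH q)
    (hdom : ∀ k : Fin N, ∑ i ∈ Finset.Iic k, p i ≤ ∑ i ∈ Finset.Iic k, q i)
    (μ ν : Measure (ℤ → Fin N)) (hμ : IsBernoulli p μ) (hν : IsBernoulli q ν)
    (ε : ℝ) (hε : 0 < ε) :
    Dense {ζ : ↥(MonotoneJoinings μ ν) |
      IsAlmostFactor ((ζ : ProbabilityMeasure ((ℤ → Fin N) × (ℤ → Fin N))) :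
        Measure ((ℤ → Fin N) × (ℤ → Fin N))) ε} := by
  intro ζ
  have hζ := MonotoneSinai.isJoining_of_mem hp0 hp1 hq0 hq1 hμ hν ζ.2
  obtain rfl := MonotoneSinai.isBernoulli_eq_iidMeasure hp0 hp1 hμ
  obtain rfl := MonotoneSinai.isBernoulli_eq_iidMeasure hq0 hq1 hν
  choose ζs hmem hfac hle using fun k : ℕ =>
    hζ.exists_almostFactor hp0 hp1 hq0 hq1 hH hε (Nat.one_div_pos_of_nat (α := ℝ) (n := k))
      (2 * k) (-k)
  exact mem_closure_of_tendsto (f := fun k => ⟨ζs k, hmem k⟩)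
    (tendsto_subtype_rng.2 (MonotoneSinai.tendsto_of_le_pairWord hle))
    (Filter.Eventually.of_forall hfac)
end
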